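/- arXiv:math/0501109 — 2 statements merged into one kernel-verified Lean document; each statement's English description precedes it below -/
import Mathlib

section
/- Let w ∈ S_N with w ≥ (w∘ⁿ,w∘ᵐ) in the Bruhat order. Then the Zariski closure of P_w in M_{m,n}(ℂ) equals the disjoint union of the sets P_z over all z ∈ S_N with (w∘ⁿ,w∘ᵐ) ≤ z ≤ w, and this set also equals {x ∈ M_{m,n}(ℂ) : the block matrix [[w∘ⁿ,0],[x,w∘ᵐ]] lies in the closure of B_N⁺ w B_N⁺ in GL_N(ℂ)}. -/
open Matrix

noncomputable section

abbrev Mat (k l : ℕ) := Matrix (Fin k) (Fin l) ℂ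

/-- permutation matrix: (i,j) entry is 1 exactly when i = w j -/
def permMat (k : ℕ) (w : Equiv.Perm (Fin k)) : Mat k k :=
  fun i j => if i = w j then 1 else 0

/-- invertible upper triangular matrices -/
def Bp (k : ℕ) : Set (Mat k k) := {M | IsUnit M ∧ ∀ i j : Fin k, j < i → M i j = 0}

/-- invertible lower triangular matrices -/
def Bm (k : ℕ) : Set (Mat k k) := {M | IsUnit M ∧ ∀ i j : Fin k, i < j → M i j = 0}

def dcPlus {k l : ℕ} (w : Mat k l) : Set (Mat k l) :=
  {x | ∃ b ∈ Bp k, ∃ b' ∈ Bp l, x = b * w * b'}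

def dcMinus {k l : ℕ} (w : Mat k l) : Set (Mat k l) :=
  {x | ∃ b ∈ Bm k, ∃ b' ∈ Bm l, x = b * w * b'}

/-- comparison of finsets: sorted lists compare termwise -/
def finsetLE {k : ℕ} (A B : Finset (Fin k)) : Prop :=
  List.Forall₂ (· ≤ ·) (A.sort (· ≤ ·)) (B.sort (· ≤ ·))

/-- Bruhat order on S_k -/
def bruhatLE {k : ℕ} (y z : Equiv.Perm (Fin k)) : Prop :=
  ∀ p : Fin k, finsetLE ((Finset.Iic p).image y) ((Finset.Iic p).image z)

/-- Zariski closure in the space of k×l matrices -/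
def zClosure {k l : ℕ} (S : Set (Mat k l)) : Set (Mat k l) :=
  {x | ∀ p : MvPolynomial (Fin k × Fin l) ℂ,
      (∀ y ∈ S, MvPolynomial.eval (fun q => y q.1 q.2) p = 0) →
      MvPolynomial.eval (fun q => x q.1 q.2) p = 0}

def revP (k : ℕ) : Equiv.Perm (Fin k) := ⟨Fin.rev, Fin.rev, Fin.rev_rev, Fin.rev_rev⟩

def fe (m n : ℕ) : Fin n ⊕ Fin m ≃ Fin (m + n) :=
  finSumFinEquiv.trans (finCongr (Nat.add_comm n m))

/-- the block matrix [[w∘ⁿ, 0],[x, w∘ᵐ]] -/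
def embMat (m n : ℕ) (x : Mat m n) : Mat (m+n) (m+n) :=
  Matrix.reindex (fe m n) (fe m n)
    (Matrix.fromBlocks (permMat n (revP n)) 0 x (permMat m (revP m)))

/-- the permutation (w∘ⁿ,w∘ᵐ) ∈ S_{m+n} -/
def wnmPerm (m n : ℕ) : Equiv.Perm (Fin (m+n)) :=
  ((fe m n).symm.trans (Equiv.sumCongr (revP n) (revP m))).trans (fe m n)

def Pset (m n : ℕ) (w : Equiv.Perm (Fin (m+n))) : Set (Mat m n) :=
  {x | embMat m n x ∈ dcPlus (permMat (m+n) w)}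

/-- the matrix with t×t identity in upper-left corner, zeros elsewhere -/
def Imn (m n t : ℕ) : Mat m n := fun i j => if (i:ℕ) = (j:ℕ) ∧ (i:ℕ) < t then 1 else 0

/-- diagonal matrix with first t diagonal entries 0 and the rest 1 -/
def Jk (k t : ℕ) : Mat k k := fun i j => if (i:ℕ) = (j:ℕ) ∧ t ≤ (i:ℕ) then 1 else 0

noncomputable def subRank {k l : ℕ} (x : Mat k l) (R : Finset (Fin k)) (C : Finset (Fin l)) : ℕ :=
  (x.submatrix (fun i : {a // a ∈ R} => i.1) (fun j : {a // a ∈ C} => j.1)).rank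

/-- v(1) < ⋯ < v(t) -/
def headMono {k : ℕ} (t : ℕ) (v : Equiv.Perm (Fin k)) : Prop :=
  ∀ i j : Fin k, i < j → (j:ℕ) < t → v i < v j

/-- u(t+1) < ⋯ < u(k) -/
def tailMono {k : ℕ} (t : ℕ) (u : Equiv.Perm (Fin k)) : Prop :=
  ∀ i j : Fin k, i < j → t ≤ (i:ℕ) → u i < u j

def embPerm {k t : ℕ} (h : t ≤ k) (τ : Equiv.Perm (Fin t)) : Equiv.Perm (Fin k) :=
  τ.viaFintypeEmbedding (Fin.castLEEmb h)
/-- closure in GL_N(ℂ) with the subspace Zariski topology -/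
def closGL (N : ℕ) (S : Set (Mat N N)) : Set (Mat N N) :=
  zClosure S ∩ {M | IsUnit M}


/-! ### Combinatorics of the Bruhat order -/

lemma forall2_count {k : ℕ} (l1 l2 : List (Fin k)) (h : List.Forall₂ (· ≤ ·) l1 l2) (q : Fin k) :
    l1.countP (fun a => decide (q ≤ a)) ≤ l2.countP (fun a => decide (q ≤ a)) := by
  induction h with
  | nil => simp
  | @cons a b t1 t2 hab ht ih =>
    simp only [List.countP_cons, decide_eq_true_eq]
    split_ifs with h1 h2 <;> omega

lemma count_forall2 {k : ℕ} (l1 l2 : List (Fin k)) (h1 : l1.Pairwise (· ≤ ·))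
    (h2 : l2.Pairwise (· ≤ ·)) (hl : l1.length = l2.length)
    (h : ∀ q : Fin k, l1.countP (fun a => decide (q ≤ a)) ≤ l2.countP (fun a => decide (q ≤ a))) :
    List.Forall₂ (· ≤ ·) l1 l2 := by
  induction l1 generalizing l2 with
  | nil =>
    cases l2 with
    | nil => exact List.Forall₂.nil
    | cons b t => simp at hl
  | cons a t1 ih =>
    cases l2 with
    | nil => simp at hl
    | cons b t2 =>
      rw [List.pairwise_cons] at h1 h2
      have hl' : t1.length = t2.length := by simpa using hl
      have hab : a ≤ b := by
        have ha := h a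
        have e1 : (a :: t1).countP (fun c => decide (a ≤ c)) = (a :: t1).length := by
          rw [List.countP_eq_length]
          intro c hc
          rcases List.mem_cons.1 hc with rfl | hc
          · simp
          · simpa using h1.1 c hc
        rw [e1, hl] at ha
        have e2 := le_antisymm (List.countP_le_length) ha
        rw [List.countP_eq_length] at e2
        simpa using e2 b (by simp)
      refine List.Forall₂.cons hab (ih t2 h1.2 h2.2 hl' ?_)
      intro q
      by_cases hq : q ≤ b
      · have e : t2.countP (fun c => decide (q ≤ c)) = t2.length := by
          rw [List.countP_eq_length]
          intro c hc
          simpa using hq.trans (h2.1 c hc)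
        rw [e, ← hl']
        exact List.countP_le_length
      · have hqa : ¬ q ≤ a := fun hh => hq (hh.trans hab)
        have := h q
        simpa [List.countP_cons, hq, hqa] using this

lemma countP_sort {k : ℕ} (A : Finset (Fin k)) (q : Fin k) :
    (A.sort (· ≤ ·)).countP (fun a => decide (q ≤ a)) = (A.filter (fun a => q ≤ a)).card := by
  have h : ((A.sort (· ≤ ·) : List (Fin k)) : Multiset (Fin k)) = A.1 := Finset.sort_eq _ _
  rw [← Multiset.coe_countP (fun a => q ≤ a), h, Multiset.countP_eq_card_filter]
  rfl

lemma finsetLE_iff {k : ℕ} (A B : Finset (Fin k)) (hc : A.card = B.card) :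
    finsetLE A B ↔ ∀ q, (A.filter (fun a => q ≤ a)).card ≤ (B.filter (fun a => q ≤ a)).card := by
  constructor
  · intro h q
    rw [← countP_sort, ← countP_sort]
    exact forall2_count _ _ h q
  · intro h
    refine count_forall2 _ _ (Finset.pairwise_sort _ _) (Finset.pairwise_sort _ _) (by simpa using hc) ?_
    intro q
    rw [countP_sort, countP_sort]
    exact h q

/-- the rank function of a permutation -/
def rk {k : ℕ} (z : Equiv.Perm (Fin k)) (p q : Fin k) : ℕ :=
  (Finset.univ.filter (fun a => a ≤ p ∧ q ≤ z a)).card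

lemma rk_eq {k : ℕ} (z : Equiv.Perm (Fin k)) (p q : Fin k) :
    (((Finset.Iic p).image z).filter (fun a => q ≤ a)).card = rk z p q := by
  rw [Finset.filter_image, Finset.card_image_of_injective _ z.injective, rk]
  congr 1
  ext a
  simp

lemma bruhatLE_iff {k : ℕ} (y z : Equiv.Perm (Fin k)) :
    bruhatLE y z ↔ ∀ p q, rk y p q ≤ rk z p q := by
  unfold bruhatLE
  refine forall_congr' fun p => ?_
  rw [finsetLE_iff _ _ (by
    rw [Finset.card_image_of_injective _ y.injective, Finset.card_image_of_injective _ z.injective])]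
  simp only [rk_eq]

/-- one step up in the Bruhat order -/
lemma bruhat_step {k : ℕ} (z w : Equiv.Perm (Fin k)) (h : ∀ p q, rk z p q ≤ rk w p q)
    (hne : z ≠ w) : ∃ i j : Fin k, i < j ∧ z i < z j ∧
      ∀ p q, rk (z * Equiv.swap i j) p q ≤ rk w p q := by
  classical
  -- first difference
  have hex : (Finset.univ.filter (fun a => z a ≠ w a)).Nonempty := by
    by_contra hcon
    apply hne
    ext a
    by_contra ha
    exact hcon ⟨a, by simpa [Fin.ext_iff] using ha⟩
  obtain ⟨i, hi, himin⟩ : ∃ i, z i ≠ w i ∧ ∀ a < i, z a = w a := by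
    refine ⟨_, (Finset.mem_filter.1 (Finset.min'_mem _ hex)).2, ?_⟩
    intro a ha
    by_contra hc
    exact absurd (Finset.min'_le _ a (by simpa using hc)) (not_le.2 ha)
  have hlt : z i < w i := by
    by_contra hcon
    have hgt : w i < z i := lt_of_le_of_ne (not_lt.1 hcon) (Ne.symm hi)
    have := h i (z i)
    refine absurd this (not_le.2 ?_)
    unfold rk
    apply Finset.card_lt_card
    rw [Finset.ssubset_iff_of_subset]
    · exact ⟨i, by simp, by simp [hgt]⟩
    · intro a ha
      simp only [Finset.mem_filter, Finset.mem_univ, true_and] at ha ⊢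
      rcases ha.1.lt_or_eq with hai | rfl
      · exact ⟨ha.1, by rw [himin a hai]; exact ha.2⟩
      · exact absurd ha.2 (not_le.2 hgt)
  -- choose j
  have hexj : (Finset.univ.filter (fun a => i < a ∧ z i < z a ∧ z a ≤ w i)).Nonempty := by
    refine ⟨z.symm (w i), ?_⟩
    simp only [Finset.mem_filter, Finset.mem_univ, true_and, Equiv.apply_symm_apply, le_refl,
      and_true]
    refine ⟨?_, hlt⟩
    rcases lt_trichotomy i (z.symm (w i)) with h1 | h1 | h1
    · exact h1
    · exfalso
      apply hi
      conv_lhs => rw [h1]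
      simp
    · have := himin _ h1
      simp only [Equiv.apply_symm_apply] at this
      have := w.injective this
      exact absurd h1 (by rw [← this]; exact lt_irrefl _)
  obtain ⟨j, ⟨hij, hzij, hzj⟩, hjmin⟩ : ∃ j, (i < j ∧ z i < z j ∧ z j ≤ w i) ∧
      ∀ a, i < a → a < j → ¬ (z i < z a ∧ z a ≤ w i) := by
    refine ⟨_, (Finset.mem_filter.1 (Finset.min'_mem _ hexj)).2, ?_⟩
    intro a hia haj hc
    exact absurd (Finset.min'_le _ a (by simpa using ⟨hia, hc⟩)) (not_le.2 haj)
  refine ⟨i, j, hij, hzij, ?_⟩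
  intro p q
  -- conditions under which the rank changes
  have hcard : rk (z * Equiv.swap i j) p q =
      (Finset.univ.filter (fun a => Equiv.swap i j a ≤ p ∧ q ≤ z a)).card := by
    unfold rk
    apply Finset.card_bij (fun a _ => Equiv.swap i j a)
    · intro a ha
      rw [Finset.mem_filter, Equiv.Perm.mul_apply] at ha
      rw [Finset.mem_filter]
      simpa using ha
    · intro a _ b _ hab
      exact (Equiv.swap i j).injective hab
    · intro b hb
      refine ⟨Equiv.swap i j b, ?_, by simp⟩
      rw [Finset.mem_filter] at hb
      rw [Finset.mem_filter, Equiv.Perm.mul_apply]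
      simpa using hb
  rw [hcard]
  by_cases hpq : (i ≤ p ∧ p < j) ∧ (z i < q ∧ q ≤ z j)
  · obtain ⟨⟨hip, hpj⟩, hiq, hqj⟩ := hpq
    -- split the count for w at w i
    have hA : (Finset.univ.filter (fun a => Equiv.swap i j a ≤ p ∧ q ≤ z a)) ⊆
        insert j (Finset.univ.filter (fun a => a ≤ p ∧ w i < z a) ∪
          Finset.univ.filter (fun a => a < i ∧ q ≤ w a ∧ w a ≤ w i)) := by
      intro a ha
      simp only [Finset.mem_filter, Finset.mem_univ, true_and, Finset.mem_insert,
        Finset.mem_union] at ha ⊢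
      by_cases haj : a = j
      · exact Or.inl haj
      right
      have hai : a ≠ i := by
        rintro rfl
        exact absurd ha.2 (not_le.2 hiq)
      rw [Equiv.swap_apply_of_ne_of_ne hai haj] at ha
      by_cases hwa : w i < z a
      · exact Or.inl ⟨ha.1, hwa⟩
      right
      rcases lt_or_gt_of_ne hai with h1 | h1
      · rw [← himin a h1]
        exact ⟨h1, ha.2, not_lt.1 hwa⟩
      · exact absurd ⟨hiq.trans_le ha.2, not_lt.1 hwa⟩ (hjmin a h1 (ha.1.trans_lt hpj))
    have hB : insert i (Finset.univ.filter (fun a => a ≤ p ∧ w i < w a) ∪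
          Finset.univ.filter (fun a => a < i ∧ q ≤ w a ∧ w a ≤ w i)) ⊆
        Finset.univ.filter (fun a => a ≤ p ∧ q ≤ w a) := by
      intro a ha
      simp only [Finset.mem_filter, Finset.mem_univ, true_and, Finset.mem_insert,
        Finset.mem_union] at ha ⊢
      rcases ha with rfl | ha | ha
      · exact ⟨hip, hqj.trans hzj⟩
      · exact ⟨ha.1, (hqj.trans hzj).trans ha.2.le⟩
      · exact ⟨ha.1.le.trans hip, ha.2.1⟩
    have hC : (Finset.univ.filter (fun a => a ≤ p ∧ w i < z a)).card ≤
        (Finset.univ.filter (fun a => a ≤ p ∧ w i < w a)).card := by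
      by_cases hlast : (w i : ℕ) + 1 < k
      · have := h p ⟨(w i : ℕ) + 1, hlast⟩
        have e : ∀ b : Fin k, ((⟨(w i : ℕ) + 1, hlast⟩ : Fin k) ≤ b) ↔ w i < b := fun b => Iff.rfl
        unfold rk at this
        simp only [e] at this
        exact this
      · have : (Finset.univ.filter (fun a => a ≤ p ∧ w i < z a)) = ∅ := by
          ext a
          simp only [Finset.mem_filter, Finset.mem_univ, true_and, Finset.notMem_empty, iff_false]
          rintro ⟨_, h2⟩
          have := (z a).2
          rw [Fin.lt_def] at h2
          omega
        rw [this]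
        simp
    have hB' := Finset.card_le_card hB
    have hA' := Finset.card_le_card hA
    have hni : i ∉ (Finset.univ.filter (fun a => a ≤ p ∧ w i < w a) ∪
          Finset.univ.filter (fun a => a < i ∧ q ≤ w a ∧ w a ≤ w i)) := by simp
    rw [Finset.card_insert_of_notMem hni, Finset.card_union_of_disjoint] at hB'
    · have := Finset.card_insert_le j (Finset.univ.filter (fun a => a ≤ p ∧ w i < z a) ∪
          Finset.univ.filter (fun a => a < i ∧ q ≤ w a ∧ w a ≤ w i))
      have := Finset.card_union_le (Finset.univ.filter (fun a => a ≤ p ∧ w i < z a))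
          (Finset.univ.filter (fun a => a < i ∧ q ≤ w a ∧ w a ≤ w i))
      unfold rk
      omega
    · rw [Finset.disjoint_left]
      intro a ha hb
      simp only [Finset.mem_filter, Finset.mem_univ, true_and] at ha hb
      exact absurd hb.2.2 (not_le.2 ha.2)
  · refine le_trans ?_ (h p q)
    rw [rk]
    by_cases hp : i ≤ p ∧ p < j
    · -- then q ≤ z i or z j < q
      rcases not_and_or.1 (fun hh => hpq ⟨hp, hh⟩) with hq | hq
      · rw [not_lt] at hq
        apply le_of_eq
        apply Finset.card_bij (fun a _ => Equiv.swap i j a)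
        · intro a ha
          simp only [Finset.mem_filter, Finset.mem_univ, true_and] at ha ⊢
          refine ⟨ha.1, ?_⟩
          by_cases h1 : a = i
          · subst h1; rw [Equiv.swap_apply_left]; exact hq.trans hzij.le
          · by_cases h2 : a = j
            · subst h2; rw [Equiv.swap_apply_right]; exact hq
            · rw [Equiv.swap_apply_of_ne_of_ne h1 h2]; exact ha.2
        · intro a _ b _ hab
          exact (Equiv.swap i j).injective hab
        · intro a ha
          refine ⟨Equiv.swap i j a, ?_, by simp⟩
          simp only [Finset.mem_filter, Finset.mem_univ, true_and] at ha ⊢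
          refine ⟨by simpa using ha.1, ?_⟩
          by_cases h1 : a = i
          · subst h1; rw [Equiv.swap_apply_left]; exact hq.trans hzij.le
          · by_cases h2 : a = j
            · subst h2; rw [Equiv.swap_apply_right]; exact hq
            · rw [Equiv.swap_apply_of_ne_of_ne h1 h2]; exact ha.2
      · apply Finset.card_le_card
        intro a ha
        simp only [Finset.mem_filter, Finset.mem_univ, true_and] at ha ⊢
        refine ⟨?_, ha.2⟩
        rw [Equiv.swap_apply_of_ne_of_ne] at ha
        · exact ha.1
        · rintro rfl; exact hq (ha.2.trans hzij.le)
        · rintro rfl; exact hq ha.2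
    · apply Finset.card_le_card
      intro a ha
      simp only [Finset.mem_filter, Finset.mem_univ, true_and] at ha ⊢
      refine ⟨?_, ha.2⟩
      by_cases h1 : a = i
      · subst h1; rw [Equiv.swap_apply_left] at ha; exact hij.le.trans ha.1
      · by_cases h2 : a = j
        · subst h2; rw [Equiv.swap_apply_right] at ha
          by_contra hc
          exact hp ⟨ha.1, not_le.1 hc⟩
        · rw [Equiv.swap_apply_of_ne_of_ne h1 h2] at ha; exact ha.1

lemma measure_swap {k : ℕ} (z : Equiv.Perm (Fin k)) (i j : Fin k) (hij : i < j) (hz : z i < z j) :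
    ∑ a : Fin k, (a : ℕ) * ((z * Equiv.swap i j) a : ℕ) < ∑ a : Fin k, (a : ℕ) * (z a : ℕ) := by
  have hne : i ≠ j := hij.ne
  have key : ∀ f : Fin k → ℕ, ∑ a, f a = f i + f j + ∑ a ∈ (Finset.univ.erase i).erase j, f a := by
    intro f
    rw [← Finset.add_sum_erase Finset.univ f (Finset.mem_univ i),
      ← Finset.add_sum_erase (Finset.univ.erase i) f (a := j) (by simp [hne.symm]), add_assoc]
  rw [key, key (fun a : Fin k => (a : ℕ) * (z a : ℕ))]
  have hrest : ∑ a ∈ (Finset.univ.erase i).erase j, (a : ℕ) * ((z * Equiv.swap i j) a : ℕ) =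
      ∑ a ∈ (Finset.univ.erase i).erase j, (a : ℕ) * (z a : ℕ) := by
    apply Finset.sum_congr rfl
    intro a ha
    simp only [Finset.mem_erase, Finset.mem_univ, and_true] at ha
    simp [Equiv.swap_apply_of_ne_of_ne ha.2 ha.1]
  rw [hrest]
  simp only [Equiv.Perm.mul_apply, Equiv.swap_apply_left, Equiv.swap_apply_right]
  rw [Fin.lt_def] at hij hz
  have : (i : ℕ) * (z j : ℕ) + j * (z i : ℕ) < i * (z i : ℕ) + j * (z j : ℕ) := by
    obtain ⟨c, hc⟩ := Nat.exists_eq_add_of_lt hij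
    obtain ⟨d, hd⟩ := Nat.exists_eq_add_of_lt hz
    rw [hc, hd]
    nlinarith
  omega

lemma rk_antisymm {k : ℕ} (z w : Equiv.Perm (Fin k)) (h : ∀ p q, rk z p q = rk w p q) : z = w := by
  by_contra hne
  obtain ⟨i, j, hij, hz, hs⟩ := bruhat_step z w (fun p q => (h p q).le) hne
  have h1 := hs i (z j)
  rw [← h] at h1
  refine absurd h1 (not_le.2 ?_)
  unfold rk
  apply Finset.card_lt_card
  rw [Finset.ssubset_iff_of_subset]
  · exact ⟨i, by rw [Finset.mem_filter, Equiv.Perm.mul_apply]; simp, by simp [hz]⟩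
  · intro a ha
    simp only [Finset.mem_filter, Finset.mem_univ, true_and] at ha ⊢
    refine ⟨ha.1, ?_⟩
    rcases eq_or_ne a i with rfl | h1
    · simp
    · rw [Equiv.Perm.mul_apply, Equiv.swap_apply_of_ne_of_ne h1 (by rintro rfl; exact absurd ha.1 (not_le.2 hij))]
      exact ha.2

/-! ### Borel subgroup, ranks -/

lemma Bp_one (k : ℕ) : (1 : Mat k k) ∈ Bp k :=
  ⟨isUnit_one, fun _ _ h => Matrix.one_apply_ne h.ne'⟩

lemma Bp_mul {k : ℕ} {a b : Mat k k} (ha : a ∈ Bp k) (hb : b ∈ Bp k) : a * b ∈ Bp k := by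
  refine ⟨ha.1.mul hb.1, ?_⟩
  intro i j hij
  rw [Matrix.mul_apply]
  apply Finset.sum_eq_zero
  intro c _
  by_cases h : c < i
  · rw [ha.2 i c h, zero_mul]
  · rw [hb.2 c j (hij.trans_le (not_lt.1 h)), mul_zero]

lemma Bp_inv {k : ℕ} {a : Mat k k} (ha : a ∈ Bp k) : a⁻¹ ∈ Bp k := by
  have hdet : IsUnit a.det := (Matrix.isUnit_iff_isUnit_det a).1 ha.1
  have : Invertible a := Matrix.invertibleOfIsUnitDet a hdet
  have ht : BlockTriangular a id := fun i j h => ha.2 i j h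
  have := blockTriangular_inv_of_blockTriangular ht
  refine ⟨?_, fun i j h => this h⟩
  exact Matrix.isUnit_nonsing_inv_iff.2 ha.1

lemma dc_mul {k : ℕ} {w x b b' : Mat k k} (hx : x ∈ dcPlus w) (hb : b ∈ Bp k) (hb' : b' ∈ Bp k) :
    b * x * b' ∈ dcPlus w := by
  obtain ⟨c, hc, c', hc', rfl⟩ := hx
  exact ⟨b * c, Bp_mul hb hc, c' * b', Bp_mul hc' hb', by simp only [Matrix.mul_assoc]⟩

lemma dc_symm {k : ℕ} {w x b b' : Mat k k} (hb : b ∈ Bp k) (hb' : b' ∈ Bp k)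
    (hx : b * x * b' ∈ dcPlus w) : x ∈ dcPlus w := by
  have := dc_mul hx (Bp_inv hb) (Bp_inv hb')
  have h1 := Matrix.nonsing_inv_mul b ((Matrix.isUnit_iff_isUnit_det b).1 hb.1)
  have h2 := Matrix.mul_nonsing_inv b' ((Matrix.isUnit_iff_isUnit_det b').1 hb'.1)
  have e : b⁻¹ * (b * x * b') * b'⁻¹ = x := by
    rw [show b⁻¹ * (b * x * b') * b'⁻¹ = (b⁻¹ * b) * x * (b' * b'⁻¹) by
      simp only [Matrix.mul_assoc], h1, h2, Matrix.one_mul, Matrix.mul_one]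
  rwa [e] at this

/-- rows ≥ q -/
def Em {k : ℕ} (q : Fin k) : Mat k k := Matrix.diagonal (fun i => if q ≤ i then 1 else 0)
/-- columns ≤ p -/
def Fm {k : ℕ} (p : Fin k) : Mat k k := Matrix.diagonal (fun i => if i ≤ p then 1 else 0)

lemma Em_mul {k : ℕ} (q : Fin k) {b : Mat k k} (hb : b ∈ Bp k) : Em q * b = Em q * b * Em q := by
  ext i j
  rw [Em, Matrix.mul_diagonal, Matrix.diagonal_mul]
  by_cases h : q ≤ i
  · by_cases h' : q ≤ j
    · simp [h']
    · simp [h', hb.2 i j ((not_le.1 h').trans_le h)]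
  · simp [h]

lemma mul_Fm {k : ℕ} (p : Fin k) {b : Mat k k} (hb : b ∈ Bp k) :
    b * Fm p = Fm p * (b * Fm p) := by
  ext i j
  rw [Fm, Matrix.diagonal_mul, Matrix.mul_diagonal]
  by_cases h : j ≤ p
  · by_cases h' : i ≤ p
    · simp [h']
    · simp [h', hb.2 i j (h.trans_lt (not_le.1 h'))]
  · simp [h]

lemma rank_le_aux {k : ℕ} (p q : Fin k) {b b' : Mat k k} (hb : b ∈ Bp k) (hb' : b' ∈ Bp k)
    (x : Mat k k) : (Em q * (b * x * b') * Fm p).rank ≤ (Em q * x * Fm p).rank := by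
  have e : Em q * (b * x * b') * Fm p = (Em q * b) * ((Em q * x * Fm p) * (b' * Fm p)) := by
    calc Em q * (b * x * b') * Fm p = (Em q * b) * x * (b' * Fm p) := by
          simp only [Matrix.mul_assoc]
      _ = (Em q * b * Em q) * x * (Fm p * (b' * Fm p)) := by rw [← Em_mul q hb, ← mul_Fm p hb']
      _ = _ := by simp only [Matrix.mul_assoc]
  rw [e]
  exact (Matrix.rank_mul_le_right _ _).trans (Matrix.rank_mul_le_left _ _)

lemma permMat_mul_apply {k l : ℕ} (w : Equiv.Perm (Fin k)) (M : Mat k l) (i : Fin k) (j : Fin l) :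
    (permMat k w * M) (w i) j = M i j := by
  rw [Matrix.mul_apply, Finset.sum_eq_single i]
  · simp [permMat]
  · intro b _ hb
    simp [permMat, hb.symm]
  · simp

lemma permMat_isUnit {k : ℕ} (w : Equiv.Perm (Fin k)) : IsUnit (permMat k w) := by
  have h : permMat k w⁻¹ * permMat k w = 1 := by
    ext i j
    obtain ⟨i, rfl⟩ := (w⁻¹).surjective i
    rw [permMat_mul_apply]
    by_cases hh : i = w j
    · subst hh
      rw [show w⁻¹ (w j) = j from w.symm_apply_apply j]
      simp [permMat]
    · have : w⁻¹ i ≠ j := by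
        rintro rfl; simp at hh
      rw [Matrix.one_apply_ne this]
      simp [permMat, hh]
  have := Matrix.isUnit_det_of_left_inverse h
  exact (Matrix.isUnit_iff_isUnit_det _).2 this

lemma rank_permMat {k : ℕ} (w : Equiv.Perm (Fin k)) (p q : Fin k) :
    (Em q * permMat k w * Fm p).rank = rk w p q := by
  classical
  have e : Em q * permMat k w * Fm p =
      permMat k w * Matrix.diagonal (fun a => if a ≤ p ∧ q ≤ w a then (1 : ℂ) else 0) := by
    ext i j
    rw [Fm, Em, Matrix.mul_diagonal, Matrix.diagonal_mul, Matrix.mul_diagonal]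
    by_cases h : i = w j
    · subst h
      by_cases h1 : j ≤ p <;> by_cases h2 : q ≤ w j <;> simp [permMat, h1, h2]
    · simp [permMat, h]
  rw [e, Matrix.rank_mul_eq_right_of_isUnit_det _ _
    ((Matrix.isUnit_iff_isUnit_det _).1 (permMat_isUnit w)), Matrix.rank_diagonal, rk,
    Fintype.card_subtype]
  congr 1
  ext a
  simp

lemma rank_dc {k : ℕ} (w : Equiv.Perm (Fin k)) (p q : Fin k) {x : Mat k k}
    (hx : x ∈ dcPlus (permMat k w)) : (Em q * x * Fm p).rank = rk w p q := by
  rw [← rank_permMat]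
  obtain ⟨b, hb, b', hb', rfl⟩ := hx
  apply le_antisymm (rank_le_aux p q hb hb' _)
  have h1 := Matrix.nonsing_inv_mul b ((Matrix.isUnit_iff_isUnit_det b).1 hb.1)
  have h2 := Matrix.mul_nonsing_inv b' ((Matrix.isUnit_iff_isUnit_det b').1 hb'.1)
  have e : b⁻¹ * (b * permMat k w * b') * b'⁻¹ = permMat k w := by
    rw [show b⁻¹ * (b * permMat k w * b') * b'⁻¹ = (b⁻¹ * b) * permMat k w * (b' * b'⁻¹) by
      simp only [Matrix.mul_assoc], h1, h2, Matrix.one_mul, Matrix.mul_one]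
  have := rank_le_aux p q (Bp_inv hb) (Bp_inv hb') (b * permMat k w * b')
  rwa [e] at this

/-- witnesses for the rank -/
lemma rank_witness {k : ℕ} (A : Mat k k) (s : ℕ) (hs : A.rank = s) :
    ∃ (P : Mat s k) (Q : Mat k s), P * A * Q = 1 := by
  subst hs
  let R := LinearMap.range A.mulVecLin
  let bs : Module.Basis (Fin A.rank) ℂ R := Module.finBasis ℂ R
  have hQ : ∀ i, ∃ v, A.mulVecLin v = (bs i : Fin k → ℂ) := fun i => (bs i).2
  choose v hv using hQ
  obtain ⟨f, hf⟩ := LinearMap.exists_leftInverse_of_injective R.subtype (Submodule.ker_subtype R)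
  refine ⟨LinearMap.toMatrix' (bs.equivFun.toLinearMap ∘ₗ f), Matrix.of (fun a i => v i a), ?_⟩
  apply Matrix.toLin'.injective
  rw [Matrix.toLin'_mul, Matrix.toLin'_mul, Matrix.toLin'_toMatrix', Matrix.toLin'_one]
  apply LinearMap.pi_ext'
  intro i
  ext j
  have h1 : (Matrix.toLin' (Matrix.of (fun a i => v i a))) (Pi.single i 1) = v i := by
    ext a
    simp
  have h2 : Matrix.toLin' A (v i) = (bs i : Fin k → ℂ) := hv i
  have h3 : f (bs i : Fin k → ℂ) = bs i := LinearMap.congr_fun hf (bs i)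
  simp only [LinearMap.comp_apply, LinearMap.single_apply, LinearMap.id_apply]
  rw [h1, h2]
  simp only [h3, LinearEquiv.coe_coe]
  rw [Module.Basis.equivFun_apply, Module.Basis.repr_self, Finsupp.single_eq_pi_single]

lemma rank_closure {k : ℕ} (S : Set (Mat k k)) (g : Mat k k) (hg : g ∈ zClosure S) (E F : Mat k k)
    (r : ℕ) (h : ∀ y ∈ S, (E * y * F).rank ≤ r) : (E * g * F).rank ≤ r := by
  by_contra hcon
  rw [not_le] at hcon
  obtain ⟨s, hs⟩ : ∃ s, (E * g * F).rank = s := ⟨_, rfl⟩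
  rw [hs] at hcon
  obtain ⟨P, Q, hPQ⟩ := rank_witness (E * g * F) s hs
  let X : Matrix (Fin k) (Fin k) (MvPolynomial (Fin k × Fin k) ℂ) :=
    Matrix.of fun i j => MvPolynomial.X (i, j)
  let poly : MvPolynomial (Fin k × Fin k) ℂ :=
    (((P * E).map (fun c => (MvPolynomial.C c : MvPolynomial (Fin k × Fin k) ℂ)) * X : Matrix _ _ _) *
      (F * Q).map (fun c => (MvPolynomial.C c : MvPolynomial (Fin k × Fin k) ℂ)) : Matrix _ _ _).det
  have hev : ∀ y : Mat k k, MvPolynomial.eval (fun q => y q.1 q.2) poly =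
      (P * (E * y * F) * Q).det := by
    intro y
    have hX : (MvPolynomial.eval (fun q : Fin k × Fin k => y q.1 q.2)).mapMatrix X = y := by
      ext i j
      simp [X]
    have hX' : X.map (MvPolynomial.eval (fun q : Fin k × Fin k => y q.1 q.2)) = y := hX
    have hC : ∀ {a b : ℕ} (M : Mat a b), (M.map (fun c => (MvPolynomial.C c : MvPolynomial (Fin k × Fin k) ℂ))).map
        (MvPolynomial.eval (fun q : Fin k × Fin k => y q.1 q.2)) = M := by
      intro a b M
      ext i j
      simp
    simp only [poly]
    rw [RingHom.map_det, RingHom.mapMatrix_apply, Matrix.map_mul, Matrix.map_mul, hX', hC, hC]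
    simp only [Matrix.mul_assoc]
  have h0 := hg poly ?_
  · rw [hev, hPQ, Matrix.det_one] at h0
    exact one_ne_zero h0
  · intro y hy
    rw [hev]
    by_contra hdet
    have hu : IsUnit (P * (E * y * F) * Q) :=
      (Matrix.isUnit_iff_isUnit_det _).2 (isUnit_iff_ne_zero.2 hdet)
    have h1 := Matrix.rank_of_isUnit _ hu
    rw [Fintype.card_fin] at h1
    have h2 := ((Matrix.rank_mul_le_left (P * (E * y * F)) Q).trans
      (Matrix.rank_mul_le_right P _)).trans (h y hy)
    omega

lemma closure_sub {k l : ℕ} (S : Set (Mat k l)) : closure S ⊆ zClosure S := by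
  intro x hx p hp
  have hc : IsClosed {y : Mat k l | MvPolynomial.eval (fun q => y q.1 q.2) p = 0} := by
    apply isClosed_eq _ continuous_const
    have h1 : Continuous (fun y : Mat k l => fun q : Fin k × Fin l => y q.1 q.2) := by
      apply continuous_pi
      intro q
      exact continuous_id.matrix_elem q.1 q.2
    exact (MvPolynomial.continuous_eval p).comp h1
  exact closure_minimal (fun y hy => hp y hy) hc hx

/-! ### Bruhat decomposition -/

lemma Bp_of_diag {k : ℕ} (M : Mat k k) (h : ∀ i j : Fin k, j < i → M i j = 0)
    (hd : ∀ i, M i i ≠ 0) : M ∈ Bp k := by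
  refine ⟨?_, h⟩
  rw [Matrix.isUnit_iff_isUnit_det, Matrix.det_of_isUpperTriangular (fun i j hij => h i j hij),
    isUnit_iff_ne_zero]
  exact Finset.prod_ne_zero_iff.2 (fun i _ => hd i)

lemma one_add_col_mul {k : ℕ} (u : Fin k → ℂ) (i : Fin k) (M : Mat k k) (a l : Fin k) :
    ((1 + Matrix.of (fun a e => if e = i then u a else 0) : Mat k k) * M) a l
      = M a l + u a * M i l := by
  rw [Matrix.add_mul, Matrix.one_mul, Matrix.add_apply, Matrix.mul_apply]
  simp

lemma mul_one_add_row {k : ℕ} (v : Fin k → ℂ) (c : Fin k) (M : Mat k k) (a l : Fin k) :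
    (M * (1 + Matrix.of (fun e l => if e = c then v l else 0) : Mat k k)) a l
      = M a l + M a c * v l := by
  rw [Matrix.mul_add, Matrix.mul_one, Matrix.add_apply, Matrix.mul_apply]
  simp

/-- the first c columns are cleared -/
def Good {k : ℕ} (c : ℕ) (M : Mat k k) : Prop :=
  ∃ f : Fin k → Fin k, (∀ j : Fin k, (j : ℕ) < c → ∀ i, M i j = if i = f j then 1 else 0) ∧
    (∀ j : Fin k, (j : ℕ) < c → ∀ l, l ≠ j → M (f j) l = 0)

lemma good_step {k : ℕ} (c : ℕ) (hc : c < k) (M : Mat k k) (hM : IsUnit M) (h : Good c M) :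
    ∃ b ∈ Bp k, ∃ b' ∈ Bp k, Good (c + 1) (b * M * b') := by
  classical
  obtain ⟨f, hf1, hf2⟩ := h
  obtain ⟨C, hC⟩ : ∃ C : Fin k, (C : ℕ) = c := ⟨⟨c, hc⟩, rfl⟩
  have hex : (Finset.univ.filter (fun a => M a C ≠ 0)).Nonempty := by
    by_contra hcon
    have hz : ∀ a, M a C = 0 := by
      intro a
      by_contra ha
      exact hcon ⟨a, by simpa using ha⟩
    have := Matrix.det_eq_zero_of_column_eq_zero C hz
    rw [Matrix.isUnit_iff_isUnit_det, this] at hM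
    exact not_isUnit_zero hM
  obtain ⟨i, hi, himax⟩ : ∃ i, M i C ≠ 0 ∧ ∀ a, i < a → M a C = 0 := by
    refine ⟨_, (Finset.mem_filter.1 (Finset.max'_mem _ hex)).2, ?_⟩
    intro a ha
    by_contra hcon
    exact absurd (Finset.le_max' _ a (by simpa using hcon)) (not_le.2 ha)
  let u : Fin k → ℂ := fun a => if a = i then (M i C)⁻¹ - 1 else -(M a C / M i C)
  let L : Mat k k := 1 + Matrix.of (fun a e => if e = i then u a else 0)
  have hL : L ∈ Bp k := by
    apply Bp_of_diag
    · intro a e hae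
      by_cases hei : e = i
      · subst hei
        simp [L, u, Matrix.one_apply_ne hae.ne', hae.ne', himax a hae]
      · simp [L, Matrix.one_apply_ne hae.ne', hei]
    · intro a
      by_cases hai : a = i
      · subst hai
        simp [L, u, hi]
      · simp [L, hai]
  have hLM : ∀ a l, (L * M) a l = M a l + u a * M i l := one_add_col_mul u i M
  have hfi : ∀ j : Fin k, (j : ℕ) < c → f j ≠ i := by
    intro j hj hfj
    apply hi
    rw [← hfj]
    apply hf2 j hj
    rintro rfl
    omega
  have hMij : ∀ j : Fin k, (j : ℕ) < c → M i j = 0 := by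
    intro j hj
    rw [hf1 j hj, if_neg (hfi j hj).symm]
  let v : Fin k → ℂ := fun l => if l = C then 0 else -((L * M) i l)
  let R : Mat k k := 1 + Matrix.of (fun e l => if e = C then v l else 0)
  have hR : R ∈ Bp k := by
    apply Bp_of_diag
    · intro e l hle
      by_cases heC : e = C
      · subst heC
        have : M i l = 0 := hMij l (by rw [← hC]; exact hle)
        simp only [R, v, Matrix.add_apply, Matrix.one_apply_ne hle.ne', Matrix.of_apply, hle.ne,
          if_true, if_false, hLM, this]
        simp
      · simp [R, Matrix.one_apply_ne hle.ne', heC]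
    · intro a
      by_cases haC : a = C
      · subst haC
        simp [R, v]
      · simp [R, haC]
  have hM2 : ∀ a l, (L * M * R) a l = (L * M) a l + (L * M) a C * v l := mul_one_add_row v C (L * M)
  have hcolC : ∀ a, (L * M) a C = if a = i then 1 else 0 := by
    intro a
    rw [hLM]
    by_cases hai : a = i
    · subst hai
      simp only [u, if_true]
      field_simp
      ring
    · simp only [u, hai, if_false]
      field_simp
      ring
  refine ⟨L, hL, R, hR, Function.update f C i, ?_, ?_⟩
  · intro j hj a
    rcases Nat.lt_succ_iff_lt_or_eq.1 hj with hj | hj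
    · have hjC : j ≠ C := by rintro rfl; omega
      rw [Function.update_of_ne hjC, hM2, hcolC]
      have hij : (L * M) i j = 0 := by rw [hLM, hMij j hj]; simp
      have hv : v j = 0 := by simp only [v, hjC, if_false, hij, neg_zero]
      rw [hv, mul_zero, add_zero, hLM, hMij j hj, mul_zero, add_zero, hf1 j hj]
    · have hjC : j = C := by ext; omega
      subst hjC
      rw [Function.update_self, hM2, hcolC]
      simp [v]
  · intro j hj l hl
    rcases Nat.lt_succ_iff_lt_or_eq.1 hj with hj | hj
    · have hjC : j ≠ C := by rintro rfl; omega
      rw [Function.update_of_ne hjC, hM2, hcolC, if_neg (hfi j hj), zero_mul, add_zero, hLM,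
        hf2 j hj l hl]
      simp only [u, hfi j hj, if_false, hf2 j hj C hjC.symm]
      simp
    · have hjC : j = C := by ext; omega
      subst hjC
      rw [Function.update_self, hM2, hcolC]
      simp [v, hl]

lemma bruhat_exists {k : ℕ} (M : Mat k k) (hM : IsUnit M) :
    ∃ z : Equiv.Perm (Fin k), M ∈ dcPlus (permMat k z) := by
  have key : ∀ c, c ≤ k → ∃ b ∈ Bp k, ∃ b' ∈ Bp k, Good c (b * M * b') := by
    intro c
    induction c with
    | zero =>
      intro _
      exact ⟨1, Bp_one k, 1, Bp_one k, id, fun j hj => by omega, fun j hj => by omega⟩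
    | succ c ih =>
      intro hc
      obtain ⟨b, hb, b', hb', hg⟩ := ih (by omega)
      obtain ⟨d, hd, d', hd', hg'⟩ := good_step c (by omega) _ ((hb.1.mul hM).mul hb'.1) hg
      refine ⟨d * b, Bp_mul hd hb, b' * d', Bp_mul hb' hd', ?_⟩
      simpa only [Matrix.mul_assoc] using hg'
  obtain ⟨b, hb, b', hb', f, hf1, hf2⟩ := key k le_rfl
  have hinj : Function.Injective f := by
    intro j j' hjj
    by_contra hne
    have h1 := hf2 j j.2 j' (Ne.symm hne)
    rw [hf1 j' j'.2, if_pos hjj] at h1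
    exact one_ne_zero h1
  let z : Equiv.Perm (Fin k) := Equiv.ofBijective f (Finite.injective_iff_bijective.1 hinj)
  refine ⟨z, dc_symm hb hb' ?_⟩
  have e : b * M * b' = permMat k z := by
    ext i j
    rw [hf1 j j.2]
    rfl
  rw [e]
  exact ⟨1, Bp_one k, 1, Bp_one k, by simp⟩

/-! ### Degeneration curve -/

lemma permMat_mul_single {k : ℕ} (z : Equiv.Perm (Fin k)) (i j : Fin k) (s : ℂ) :
    permMat k z * Matrix.single i j s = Matrix.single (z i) j s := by
  ext a b
  obtain ⟨a, rfl⟩ := z.surjective a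
  rw [permMat_mul_apply]
  simp [Matrix.single_apply]

lemma curve_mem {k : ℕ} (z : Equiv.Perm (Fin k)) (i j : Fin k) (hij : i < j) (hz : z i < z j)
    (s : ℂ) (hs : s ≠ 0) :
    permMat k z * (1 + Matrix.single j i s) ∈ dcPlus (permMat k (z * Equiv.swap i j)) := by
  classical
  refine ⟨1 + Matrix.single (z i) (z j) s⁻¹, ?_,
    Matrix.diagonal (fun a => if a = i then s else if a = j then -s⁻¹ else 1) +
      Matrix.single i j 1, ?_, ?_⟩
  · apply Bp_of_diag
    · intro a b hab
      have : ¬ (z i = a ∧ z j = b) := by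
        rintro ⟨rfl, rfl⟩; exact absurd hz hab.not_gt
      simp [Matrix.one_apply_ne hab.ne', Matrix.single_apply, this]
    · intro a
      have : ¬ (z i = a ∧ z j = a) := by
        rintro ⟨h, h'⟩; exact hz.ne (h.trans h'.symm)
      simp [Matrix.single_apply, this]
  · apply Bp_of_diag
    · intro a b hab
      have : ¬ (i = a ∧ j = b) := by
        rintro ⟨rfl, rfl⟩; exact absurd hij hab.not_gt
      simp [Matrix.diagonal_apply_ne _ hab.ne', Matrix.single_apply, this]
    · intro a
      have : ¬ (i = a ∧ j = a) := by
        rintro ⟨h, h'⟩; exact hij.ne (h.trans h'.symm)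
      simp only [Matrix.add_apply, Matrix.diagonal_apply_eq, Matrix.single_apply, this, if_false,
        add_zero]
      split_ifs <;> simp [hs]
  · set t := z * Equiv.swap i j with ht
    have hti : t i = z j := by simp [ht]
    have htj : t j = z i := by simp [ht]
    have hne : i ≠ j := hij.ne
    rw [Matrix.mul_assoc, Matrix.mul_add (permMat k t), permMat_mul_single, hti, Matrix.mul_add, Matrix.mul_one,
      permMat_mul_single]
    ext a b
    have e1 : ∀ N : Mat k k, ((1 + Matrix.single (z i) (z j) s⁻¹) * N) a b =
        N a b + (if z i = a then s⁻¹ * N (z j) b else 0) := by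
      intro N
      rw [Matrix.add_mul, Matrix.one_mul, Matrix.add_apply]
      congr 1
      by_cases h : z i = a
      · subst h; simp
      · rw [Matrix.single_mul_apply_of_ne _ _ _ _ _ (Ne.symm h), if_neg h]
    rw [e1]
    simp only [Matrix.add_apply, Matrix.mul_diagonal]
    obtain ⟨a, rfl⟩ := z.surjective a
    have hp : ∀ a b, permMat k t (z a) b = if a = Equiv.swap i j b then 1 else 0 := by
      intro a b
      simp [permMat, ht]
    have hp' : ∀ a b, permMat k z (z a) b = if a = b then 1 else 0 := by
      intro a b
      simp [permMat]
    rw [hp, hp, hp']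
    simp only [Matrix.single_apply, z.injective.eq_iff]
    by_cases hbi : b = i
    · subst hbi
      rw [Equiv.swap_apply_left]
      by_cases haj : a = j
      · subst haj; simp [hne, hne.symm]
      · by_cases hai : a = b
        · subst hai; simp [hne, hne.symm, hs]
        · simp [hai, haj, hne, hne.symm, Ne.symm hai, Ne.symm haj]
    · by_cases hbj : b = j
      · subst hbj
        rw [Equiv.swap_apply_right]
        by_cases hab : a = b
        · subst hab; simp [hne, hne.symm]
        · by_cases hai : a = i
          · subst hai; simp [hne, hne.symm]
          · simp [hai, hab, hne, hne.symm, Ne.symm hai, Ne.symm hab]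
      · rw [Equiv.swap_apply_of_ne_of_ne hbi hbj]
        simp [hbi, hbj, Ne.symm hbi, Ne.symm hbj]

/-! ### The slice -/

lemma fe_inl (m n : ℕ) (a : Fin n) : ((fe m n (Sum.inl a) : Fin (m + n)) : ℕ) = a := by
  simp [fe]

lemma fe_inr (m n : ℕ) (a : Fin m) : ((fe m n (Sum.inr a) : Fin (m + n)) : ℕ) = n + a := by
  simp [fe, Nat.add_comm]

/-- the linear part of the embedding -/
def embL (m n : ℕ) (x : Mat m n) : Mat (m+n) (m+n) :=
  Matrix.reindex (fe m n) (fe m n) (Matrix.fromBlocks 0 0 x 0)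

lemma embMat_add (m n : ℕ) (x y : Mat m n) : embMat m n (x + y) = embMat m n x + embL m n y := by
  ext a b
  obtain ⟨a, rfl⟩ := (fe m n).surjective a
  obtain ⟨b, rfl⟩ := (fe m n).surjective b
  rcases a with a | a <;> rcases b with b | b <;> simp [embMat, embL]

lemma embL_smul (m n : ℕ) (t : ℂ) (y : Mat m n) : embL m n (t • y) = t • embL m n y := by
  ext a b
  obtain ⟨a, rfl⟩ := (fe m n).surjective a
  obtain ⟨b, rfl⟩ := (fe m n).surjective b
  rcases a with a | a <;> rcases b with b | b <;> simp [embL]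

/-- the upper triangular part -/
def up {k : ℕ} (M : Mat k k) : Mat k k := fun i j => if i ≤ j then M i j else 0

lemma up_smul {k : ℕ} (t : ℂ) (M : Mat k k) : up (t • M) = t • up M := by
  ext a b
  simp [up]

lemma solve_rev (k : ℕ) (H : Mat k k) : ∃ N β : Mat k k, (∀ i j, j < i → N i j = 0) ∧
    (∀ i j, j < i → β i j = 0) ∧
    N * permMat k (revP k) + permMat k (revP k) * β = H := by
  refine ⟨Matrix.of fun a c => if a ≤ c then H a c.rev else 0,
    Matrix.of fun c b => if c < b then H c.rev b else 0,
    ?_, ?_, ?_⟩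
  · intro i j hij
    simp [not_le.2 hij]
  · intro i j hij
    simp [not_lt.2 hij.le]
  · ext a b
    have hr : ∀ c : Fin k, revP k c = c.rev := fun c => rfl
    have h1 : ∀ N : Mat k k, (N * permMat k (revP k)) a b = N a b.rev := by
      intro N
      rw [Matrix.mul_apply, Finset.sum_eq_single b.rev]
      · simp [permMat, hr]
      · intro c _ hc
        simp [permMat, hr, hc]
      · simp
    have h2 : ∀ N : Mat k k, (permMat k (revP k) * N) a b = N a.rev b := by
      intro N
      have := permMat_mul_apply (revP k) N a.rev b
      rwa [hr, Fin.rev_rev] at this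
    rw [Matrix.add_apply, h1, h2]
    simp only [Fin.rev_rev, Matrix.of_apply]
    by_cases h : a ≤ b.rev
    · have : ¬ a.rev < b := by
        rw [not_lt]; exact Fin.le_rev_iff.1 h
      simp [h, this]
    · have : a.rev < b := by
        rw [not_le] at h; exact Fin.rev_lt_iff.1 h
      simp [h, this]

lemma up_blocks (m n : ℕ) (A : Mat n n) (B : Mat n m) (D : Mat m m)
    (hA : ∀ i j, j < i → A i j = 0) (hD : ∀ i j, j < i → D i j = 0) :
    up (Matrix.reindex (fe m n) (fe m n) (Matrix.fromBlocks A B 0 D)) =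
      Matrix.reindex (fe m n) (fe m n) (Matrix.fromBlocks A B 0 D) := by
  ext a b
  obtain ⟨a, rfl⟩ := (fe m n).surjective a
  obtain ⟨b, rfl⟩ := (fe m n).surjective b
  unfold up
  by_cases hab : fe m n a ≤ fe m n b
  · rw [if_pos hab]
  · rw [if_neg hab]
    rw [not_le, Fin.lt_def] at hab
    rcases a with a | a <;> rcases b with b | b <;>
      simp only [fe_inl, fe_inr] at hab <;> simp
    · rw [hA a b hab]
    · omega
    · rw [hD a b (by rw [Fin.lt_def]; omega)]

lemma solve_tangent (m n : ℕ) (x : Mat m n) (H : Mat (m+n) (m+n)) :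
    ∃ (N β : Mat (m+n) (m+n)) (ξ : Mat m n),
      up N * embMat m n x + embL m n ξ + embMat m n x * up β = H := by
  obtain ⟨H, rfl⟩ := (Matrix.reindex (fe m n) (fe m n)).surjective H
  obtain ⟨H11, H12, H21, H22, rfl⟩ : ∃ H11 H12 H21 H22, H = Matrix.fromBlocks H11 H12 H21 H22 :=
    ⟨_, _, _, _, (Matrix.fromBlocks_toBlocks H).symm⟩
  obtain ⟨N1, β1, hN1, hβ1, e1⟩ := solve_rev n H11
  have hww : permMat n (revP n) * permMat n (revP n) = 1 := by
    ext a b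
    have := permMat_mul_apply (revP n) (permMat n (revP n)) (revP n a) b
    have hr : revP n (revP n a) = a := Fin.rev_rev a
    rw [hr] at this
    rw [this]
    simp [permMat, Matrix.one_apply]
  let β12 : Mat n m := permMat n (revP n) * H12
  have e12 : permMat n (revP n) * β12 = H12 := by
    simp only [β12]
    rw [← Matrix.mul_assoc, hww, Matrix.one_mul]
  obtain ⟨N2, β2, hN2, hβ2, e2⟩ := solve_rev m (H22 - x * β12)
  refine ⟨Matrix.reindex (fe m n) (fe m n) (Matrix.fromBlocks N1 0 0 N2),
    Matrix.reindex (fe m n) (fe m n) (Matrix.fromBlocks β1 β12 0 β2),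
    H21 - N2 * x - x * β1, ?_⟩
  rw [up_blocks _ _ _ _ _ hN1 hN2, up_blocks _ _ _ _ _ hβ1 hβ2]
  simp only [embMat, embL, Matrix.reindex_apply]
  rw [Matrix.submatrix_mul_equiv, Matrix.submatrix_mul_equiv]
  have hsub : ∀ A B : Matrix (Fin n ⊕ Fin m) (Fin n ⊕ Fin m) ℂ,
      A.submatrix (fe m n).symm (fe m n).symm + B.submatrix (fe m n).symm (fe m n).symm =
        (A + B).submatrix (fe m n).symm (fe m n).symm := fun A B => rfl
  rw [hsub, hsub]
  congr 1
  rw [Matrix.fromBlocks_multiply, Matrix.fromBlocks_multiply, Matrix.fromBlocks_add,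
    Matrix.fromBlocks_add]
  congr 1
  · simpa using e1
  · simpa using e12
  · simp only [Matrix.mul_zero, zero_add, add_zero, Matrix.zero_mul]
    abel
  · have : N2 * permMat m (revP m) + (x * β12 + permMat m (revP m) * β2) =
        x * β12 + (N2 * permMat m (revP m) + permMat m (revP m) * β2) := by abel
    simp only [Matrix.mul_zero, zero_add, add_zero]
    rw [this, e2]
    abel

/-- the slice map -/
def sliceF (m n : ℕ) (p : (Fin (m+n) → Fin (m+n) → ℂ) × (Fin m → Fin n → ℂ) ×
    (Fin (m+n) → Fin (m+n) → ℂ)) : Fin (m+n) → Fin (m+n) → ℂ :=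
  fun a b => ((1 + up (Matrix.of p.1)) * embMat m n (Matrix.of p.2.1) * (1 + up (Matrix.of p.2.2))) a b

lemma sliceF_contDiff (m n : ℕ) : ContDiff ℂ 1 (sliceF m n) := by
  have hent : ∀ {k l : ℕ} (a : Fin k) (b : Fin l),
      ContDiff ℂ 1 (fun M : Fin k → Fin l → ℂ => M a b) := by
    intro k l a b
    fun_prop
  have hup : ∀ a b : Fin (m+n), ContDiff ℂ 1
      (fun M : Fin (m+n) → Fin (m+n) → ℂ => (1 + up (Matrix.of M) : Mat (m+n) (m+n)) a b) := by
    intro a b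
    by_cases hab : a ≤ b
    · simp only [Matrix.add_apply, up, hab, if_true, Matrix.of_apply]
      exact contDiff_const.add (hent a b)
    · simp only [Matrix.add_apply, up, hab, if_false]
      exact contDiff_const
  have hemb : ∀ a b : Fin (m+n), ContDiff ℂ 1
      (fun M : Fin m → Fin n → ℂ => embMat m n (Matrix.of M) a b) := by
    intro a b
    obtain ⟨a, rfl⟩ := (fe m n).surjective a
    obtain ⟨b, rfl⟩ := (fe m n).surjective b
    rcases a with a | a <;> rcases b with b | b <;> simp [embMat]
    · exact contDiff_const
    · exact contDiff_const
    · exact hent a b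
    · exact contDiff_const
  rw [contDiff_pi]
  intro a
  rw [contDiff_pi]
  intro b
  simp only [sliceF, Matrix.mul_apply]
  apply ContDiff.sum
  intro c _
  apply ContDiff.mul
  · apply ContDiff.sum
    intro d _
    exact ((hup a d).comp contDiff_fst).mul ((hemb d c).comp (contDiff_fst.comp contDiff_snd))
  · exact (hup c b).comp (contDiff_snd.comp contDiff_snd)

lemma sliceF_nhds (m n : ℕ) (x : Mat m n) :
    Filter.map (sliceF m n) (nhds ((0 : Fin (m+n) → Fin (m+n) → ℂ),
      ((x : Fin m → Fin n → ℂ), (0 : Fin (m+n) → Fin (m+n) → ℂ)))) =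
    nhds (sliceF m n ((0 : Fin (m+n) → Fin (m+n) → ℂ),
      ((x : Fin m → Fin n → ℂ), (0 : Fin (m+n) → Fin (m+n) → ℂ)))) := by
  set p : (Fin (m+n) → Fin (m+n) → ℂ) × (Fin m → Fin n → ℂ) × (Fin (m+n) → Fin (m+n) → ℂ) :=
    ((0 : Fin (m+n) → Fin (m+n) → ℂ),
      ((x : Fin m → Fin n → ℂ), (0 : Fin (m+n) → Fin (m+n) → ℂ))) with hp
  have hstrict := (sliceF_contDiff m n).contDiffAt.hasStrictFDerivAt (x := p) one_ne_zero
  apply hstrict.map_nhds_eq_of_surj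
  rw [LinearMap.range_eq_top]
  intro H
  obtain ⟨N, β, ξ, hH⟩ := solve_tangent m n x (Matrix.of H)
  let v : (Fin (m+n) → Fin (m+n) → ℂ) × (Fin m → Fin n → ℂ) × (Fin (m+n) → Fin (m+n) → ℂ) :=
    (N, (ξ, β))
  refine ⟨v, ?_⟩
  have hline : HasDerivAt (fun t : ℂ => p + t • v) v 0 := by
    simpa using ((hasDerivAt_id (0 : ℂ)).smul_const v).const_add p
  have h1 : HasDerivAt (fun t : ℂ => sliceF m n (p + t • v)) (fderiv ℂ (sliceF m n) p v) 0 := by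
    have h0 : HasFDerivAt (sliceF m n) (fderiv ℂ (sliceF m n) p) (p + (0 : ℂ) • v) := by
      rw [zero_smul, add_zero]
      exact hstrict.hasFDerivAt
    exact h0.comp_hasDerivAt (0 : ℂ) hline
  have hform : ∀ t : ℂ, ∀ a b, sliceF m n (p + t • v) a b =
      embMat m n x a b + t * H a b +
      t ^ 2 * ((up N * embL m n ξ + up N * embMat m n x * up β + embL m n ξ * up β) a b) +
      t ^ 3 * ((up N * embL m n ξ * up β) a b) := by
    intro t a b
    have e1 : Matrix.of (p + t • v).1 = t • N := by
      ext a b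
      simp only [hp, v, Matrix.of_apply, Prod.fst_add, Prod.smul_fst, zero_add]
      rfl
    have e2 : Matrix.of (p + t • v).2.1 = x + t • ξ := by
      ext a b
      simp only [hp, v, Matrix.of_apply, Prod.fst_add, Prod.smul_fst, Prod.snd_add, Prod.smul_snd]
      rfl
    have e3 : Matrix.of (p + t • v).2.2 = t • β := by
      ext a b
      simp only [hp, v, Matrix.of_apply, Prod.snd_add, Prod.smul_snd, zero_add]
      rfl
    have e4 : H a b = (up N * embMat m n x + embL m n ξ + embMat m n x * up β) a b := by
      rw [hH]; rfl
    unfold sliceF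
    rw [e1, e2, e3, up_smul, up_smul, embMat_add, embL_smul, e4]
    have : (1 + t • up N) * (embMat m n x + t • embL m n ξ) * (1 + t • up β) =
        embMat m n x + t • (up N * embMat m n x + embL m n ξ + embMat m n x * up β) +
        t ^ 2 • (up N * embL m n ξ + up N * embMat m n x * up β + embL m n ξ * up β) +
        t ^ 3 • (up N * embL m n ξ * up β) := by
      simp only [add_mul, mul_add, one_mul, mul_one, smul_mul_assoc, mul_smul_comm, smul_add,
        smul_smul]
      rw [show t ^ 2 = t * t by ring, show t ^ 3 = t * (t * t) by ring]
      abel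
    rw [this]
    simp only [Matrix.add_apply, Matrix.smul_apply, smul_eq_mul]
  have h2 : HasDerivAt (fun t : ℂ => sliceF m n (p + t • v)) H 0 := by
    rw [hasDerivAt_pi]
    intro a
    rw [hasDerivAt_pi]
    intro b
    simp only [hform]
    have ht := hasDerivAt_id (0 : ℂ)
    have := (((ht.mul_const (H a b)).const_add (embMat m n x a b)).add
      ((ht.pow 2).mul_const ((up N * embL m n ξ + up N * embMat m n x * up β + embL m n ξ * up β) a b))).add
      ((ht.pow 3).mul_const ((up N * embL m n ξ * up β) a b))
    refine HasDerivAt.congr_deriv (f' := _) this ?_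
    simp
  exact h1.unique h2

lemma sliceF_base (m n : ℕ) (x : Mat m n) :
    Matrix.of (sliceF m n ((0 : Fin (m+n) → Fin (m+n) → ℂ),
      ((x : Fin m → Fin n → ℂ), (0 : Fin (m+n) → Fin (m+n) → ℂ)))) = embMat m n x := by
  have h0 : up (Matrix.of (0 : Fin (m+n) → Fin (m+n) → ℂ)) = 0 := by
    ext a b; simp [up]
  ext a b
  simp only [Matrix.of_apply, sliceF, h0, add_zero, Matrix.one_mul, Matrix.mul_one]
  rfl

/-- nearby matrices can be moved into the slice -/
lemma slice_near (m n : ℕ) (x : Mat m n) (V : Set (Mat m n)) (hV : V ∈ nhds x) :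
    {g : Mat (m+n) (m+n) | ∃ ξ ∈ V, ∃ b ∈ Bp (m+n), ∃ b' ∈ Bp (m+n), g = b * embMat m n ξ * b'} ∈
      nhds (embMat m n x) := by
  have hU : ∀ᶠ M in nhds (0 : Fin (m+n) → Fin (m+n) → ℂ),
      (1 + up (Matrix.of M) : Mat (m+n) (m+n)) ∈ Bp (m+n) := by
    have hcont : Continuous (fun M : Fin (m+n) → Fin (m+n) → ℂ =>
        (1 + up (Matrix.of M) : Mat (m+n) (m+n)).det) := by
      apply Continuous.matrix_det
      apply continuous_matrix
      intro a b
      by_cases hab : a ≤ b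
      · simp only [Matrix.add_apply, up, hab, if_true, Matrix.of_apply]
        fun_prop
      · simp only [Matrix.add_apply, up, hab, if_false]
        fun_prop
    have hne : (1 + up (Matrix.of (0 : Fin (m+n) → Fin (m+n) → ℂ)) : Mat (m+n) (m+n)).det ≠ 0 := by
      have h0 : up (Matrix.of (0 : Fin (m+n) → Fin (m+n) → ℂ)) = 0 := by
        ext a b; simp [up]
      rw [h0]; simp
    filter_upwards [hcont.continuousAt.eventually_ne hne] with M hM
    refine ⟨(Matrix.isUnit_iff_isUnit_det _).2 (isUnit_iff_ne_zero.2 hM), ?_⟩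
    intro i j hij
    simp [Matrix.add_apply, up, not_le.2 hij, Matrix.one_apply_ne hij.ne']
  have hmap := sliceF_nhds m n x
  have hb : sliceF m n ((0 : Fin (m+n) → Fin (m+n) → ℂ),
      ((x : Fin m → Fin n → ℂ), (0 : Fin (m+n) → Fin (m+n) → ℂ))) = embMat m n x :=
    sliceF_base m n x
  rw [hb] at hmap
  have goal : {g : Fin (m+n) → Fin (m+n) → ℂ | ∃ ξ ∈ V, ∃ b ∈ Bp (m+n), ∃ b' ∈ Bp (m+n),
      Matrix.of g = b * embMat m n ξ * b'} ∈
      nhds (X := Fin (m+n) → Fin (m+n) → ℂ) (embMat m n x) := by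
    rw [← hmap, Filter.mem_map]
    have hV' : ∀ᶠ y in nhds (X := Fin m → Fin n → ℂ) x, y ∈ (V : Set (Fin m → Fin n → ℂ)) := hV
    have := hU.prod_nhds (hV'.prod_nhds hU)
    filter_upwards [this] with q hq
    exact ⟨q.2.1, hq.2.1, _, hq.1, _, hq.2.2, rfl⟩
  exact goal

lemma P_step (m n : ℕ) (z : Equiv.Perm (Fin (m+n))) (i j : Fin (m+n)) (hij : i < j)
    (hz : z i < z j) : Pset m n z ⊆ closure (Pset m n (z * Equiv.swap i j)) := by
  intro x hx
  rw [mem_closure_iff_nhds]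
  intro V hV
  obtain ⟨b, hb, b', hb', he⟩ := hx
  have hcont : Continuous (fun s : ℂ => b * (permMat (m+n) z * (1 + Matrix.single j i s)) * b') := by
    have h1 : Continuous (fun s : ℂ => (Matrix.single j i s : Mat (m+n) (m+n))) := by
      apply continuous_matrix
      intro a c
      simp only [Matrix.single_apply]
      split_ifs <;> fun_prop
    fun_prop
  have h0 : b * (permMat (m+n) z * (1 + Matrix.single j i (0 : ℂ))) * b' = embMat m n x := by
    rw [he]; simp
  have hnear := slice_near m n x V hV
  rw [← h0] at hnear
  have hev := hcont.continuousAt.preimage_mem_nhds hnear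
  have hev' : ∀ᶠ s : ℂ in nhdsWithin 0 {0}ᶜ, s ∈ (fun s : ℂ => b * (permMat (m+n) z * (1 + Matrix.single j i s)) * b') ⁻¹'
    {g : Mat (m+n) (m+n) | ∃ ξ ∈ V, ∃ b ∈ Bp (m+n), ∃ b' ∈ Bp (m+n), g = b * embMat m n ξ * b'} :=
    nhdsWithin_le_nhds hev
  obtain ⟨s, hs, hs0⟩ := (hev'.and self_mem_nhdsWithin).exists
  obtain ⟨ξ, hξ, c, hc, c', hc', hcc⟩ := hs
  refine ⟨ξ, hξ, ?_⟩
  have h1 := dc_mul (curve_mem z i j hij hz s hs0) hb hb'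
  rw [show b * (permMat (m+n) z * (1 + Matrix.single j i s)) * b' = c * embMat m n ξ * c' from hcc]
    at h1
  exact dc_symm hc hc' h1

lemma P_closure (m n : ℕ) (w : Equiv.Perm (Fin (m+n))) : ∀ (d : ℕ) (z : Equiv.Perm (Fin (m+n))),
    ∑ a : Fin (m+n), (a : ℕ) * (z a : ℕ) = d → (∀ p q, rk z p q ≤ rk w p q) →
    Pset m n z ⊆ closure (Pset m n w) := by
  intro d
  induction d using Nat.strong_induction_on with
  | _ d ih =>
    intro z hd hzw
    by_cases hne : z = w
    · subst hne; exact subset_closure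
    · obtain ⟨i, j, hij, hz, hs⟩ := bruhat_step z w hzw hne
      refine (P_step m n z i j hij hz).trans ?_
      refine closure_minimal ?_ isClosed_closure
      exact ih _ (hd ▸ measure_swap z i j hij hz) _ rfl hs

lemma embMat_zero (m n : ℕ) : embMat m n 0 = permMat (m+n) (wnmPerm m n) := by
  ext a b
  obtain ⟨a, rfl⟩ := (fe m n).surjective a
  obtain ⟨b, rfl⟩ := (fe m n).surjective b
  rcases a with a | a <;> rcases b with b | b <;> simp [embMat, permMat, wnmPerm]

lemma embMat_isUnit (m n : ℕ) (x : Mat m n) : IsUnit (embMat m n x) := by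
  rw [Matrix.isUnit_iff_isUnit_det]
  unfold embMat
  rw [Matrix.det_reindex_self, Matrix.det_fromBlocks_zero₁₂]
  exact ((Matrix.isUnit_iff_isUnit_det _).1 (permMat_isUnit _)).mul
    ((Matrix.isUnit_iff_isUnit_det _).1 (permMat_isUnit _))

lemma embMat_continuous (m n : ℕ) : Continuous (embMat m n) := by
  apply continuous_matrix
  intro a b
  obtain ⟨a, rfl⟩ := (fe m n).surjective a
  obtain ⟨b, rfl⟩ := (fe m n).surjective b
  rcases a with a | a <;> rcases b with b | b <;> simp [embMat]
  · exact continuous_const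
  · exact continuous_const
  · exact continuous_id.matrix_elem a b
  · exact continuous_const

/-- scaling by a torus element -/
lemma embMat_scale (m n : ℕ) (x : Mat m n) (t : ℂ) (ht : t ≠ 0) :
    ∃ b ∈ Bp (m+n), ∃ b' ∈ Bp (m+n), embMat m n (t • x) = b * embMat m n x * b' := by
  have hdiag : ∀ d : Fin (m+n) → ℂ, (∀ i, d i ≠ 0) → Matrix.diagonal d ∈ Bp (m+n) := by
    intro d hd
    apply Bp_of_diag
    · intro i j hij
      exact Matrix.diagonal_apply_ne _ hij.ne'
    · intro i; simpa using hd i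
  refine ⟨Matrix.diagonal (fun a => Sum.elim (fun _ => 1) (fun _ => t) ((fe m n).symm a)), hdiag _ ?_,
    Matrix.diagonal (fun a => Sum.elim (fun _ => 1) (fun _ => t⁻¹) ((fe m n).symm a)), hdiag _ ?_, ?_⟩
  · intro i
    rcases (fe m n).symm i with a | a <;> simp [ht]
  · intro i
    rcases (fe m n).symm i with a | a <;> simp [ht]
  · ext a b
    obtain ⟨a, rfl⟩ := (fe m n).surjective a
    obtain ⟨b, rfl⟩ := (fe m n).surjective b
    rw [Matrix.mul_diagonal, Matrix.diagonal_mul]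
    rcases a with a | a <;> rcases b with b | b <;> simp [embMat]
    field_simp

lemma rk_le_of_closure {k : ℕ} (z w : Equiv.Perm (Fin k)) (g : Mat k k)
    (hg : g ∈ dcPlus (permMat k z)) (hc : g ∈ zClosure (dcPlus (permMat k w))) (p q : Fin k) :
    rk z p q ≤ rk w p q := by
  rw [← rank_dc z p q hg]
  exact rank_closure _ g hc _ _ _ (fun y hy => (rank_dc w p q hy).le)

lemma wnm_le (m n : ℕ) (z : Equiv.Perm (Fin (m+n))) (x : Mat m n) (hx : x ∈ Pset m n z) :
    bruhatLE (wnmPerm m n) z := by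
  rw [bruhatLE_iff]
  refine rk_le_of_closure _ _ (embMat m n 0) ?_ ?_
  · rw [embMat_zero]
    exact ⟨1, Bp_one _, 1, Bp_one _, by simp⟩
  · apply closure_sub
    have hcont : Continuous (fun t : ℂ => embMat m n (t • x)) :=
      (embMat_continuous m n).comp (continuous_id.smul continuous_const)
    have h0 : Filter.Tendsto (fun t : ℂ => embMat m n (t • x)) (nhdsWithin 0 {0}ᶜ)
        (nhds (embMat m n 0)) := by
      have := hcont.tendsto (0 : ℂ)
      rw [zero_smul] at this
      exact this.mono_left nhdsWithin_le_nhds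
    refine mem_closure_of_tendsto h0 ?_
    filter_upwards [self_mem_nhdsWithin] with t ht
    obtain ⟨b, hb, b', hb', he⟩ := embMat_scale m n x t ht
    rw [he]
    exact dc_mul hx hb hb'

lemma emb_zClosure (m n : ℕ) (S : Set (Mat m n)) (T : Set (Mat (m+n) (m+n)))
    (h : ∀ y ∈ S, embMat m n y ∈ T) (x : Mat m n) (hx : x ∈ zClosure S) :
    embMat m n x ∈ zClosure T := by
  intro p hp
  let σ : Fin (m+n) × Fin (m+n) → MvPolynomial (Fin m × Fin n) ℂ := fun q =>
    Sum.elim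
      (fun a => Sum.elim (fun b => MvPolynomial.C (permMat n (revP n) a b)) (fun _ => 0)
        ((fe m n).symm q.2))
      (fun a => Sum.elim (fun b => MvPolynomial.X (a, b))
        (fun b => MvPolynomial.C (permMat m (revP m) a b)) ((fe m n).symm q.2))
      ((fe m n).symm q.1)
  have hev : ∀ y : Mat m n, MvPolynomial.eval (fun q => y q.1 q.2) (MvPolynomial.bind₁ σ p) =
      MvPolynomial.eval (fun q => embMat m n y q.1 q.2) p := by
    intro y
    rw [MvPolynomial.eval, MvPolynomial.eval₂Hom_bind₁]
    congr 2
    ext ⟨a, b⟩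
    obtain ⟨a, rfl⟩ := (fe m n).surjective a
    obtain ⟨b, rfl⟩ := (fe m n).surjective b
    rcases a with a | a <;> rcases b with b | b <;> simp [embMat, σ]
  rw [← hev]
  apply hx
  intro y hy
  rw [hev]
  exact hp _ (h y hy)

theorem statement5 (m n : ℕ) (hm : 0 < m) (hn : 0 < n)
    (w : Equiv.Perm (Fin (m+n))) (hw : bruhatLE (wnmPerm m n) w) :
    zClosure (Pset m n w) =
      ⋃ z ∈ {z : Equiv.Perm (Fin (m+n)) | bruhatLE (wnmPerm m n) z ∧ bruhatLE z w},
        Pset m n z ∧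
    (∀ z z' : Equiv.Perm (Fin (m+n)),
      bruhatLE (wnmPerm m n) z → bruhatLE z w → bruhatLE (wnmPerm m n) z' → bruhatLE z' w →
      z ≠ z' → Disjoint (Pset m n z) (Pset m n z')) ∧
    zClosure (Pset m n w) =
      {x : Mat m n | embMat m n x ∈ closGL (m+n) (dcPlus (permMat (m+n) w))} := by
  have h13 : zClosure (Pset m n w) ⊆
      {x : Mat m n | embMat m n x ∈ closGL (m+n) (dcPlus (permMat (m+n) w))} := by
    intro x hx
    exact ⟨emb_zClosure m n _ _ (fun y hy => hy) x hx, embMat_isUnit m n x⟩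
  have h32 : {x : Mat m n | embMat m n x ∈ closGL (m+n) (dcPlus (permMat (m+n) w))} ⊆
      ⋃ z ∈ {z : Equiv.Perm (Fin (m+n)) | bruhatLE (wnmPerm m n) z ∧ bruhatLE z w},
        Pset m n z := by
    intro x hx
    obtain ⟨z, hz⟩ := bruhat_exists _ (embMat_isUnit m n x)
    refine Set.mem_biUnion (x := z) ⟨wnm_le m n z x hz, ?_⟩ hz
    rw [bruhatLE_iff]
    exact rk_le_of_closure z w _ hz hx.1
  have h21 : (⋃ z ∈ {z : Equiv.Perm (Fin (m+n)) | bruhatLE (wnmPerm m n) z ∧ bruhatLE z w},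
        Pset m n z) ⊆ zClosure (Pset m n w) := by
    apply Set.iUnion₂_subset
    intro z hz
    exact (P_closure m n w _ z rfl ((bruhatLE_iff z w).1 hz.2)).trans (closure_sub _)
  refine ⟨(h13.trans h32).antisymm h21, ?_, h13.antisymm (h32.trans h21)⟩
  intro z z' _ _ _ _ hne
  rw [Set.disjoint_left]
  intro x hx hx'
  apply hne
  apply rk_antisymm
  intro p q
  rw [← rank_dc z p q hx, ← rank_dc z' p q hx']
end
end

section
/- Let k and l be positive integers and let x, w ∈ M_{k,l}(ℂ). Then: (a) x ∈ B_k⁺ w B_l⁺ if and only if rank(x_{[p,…,k;1,…,q]}) = rank(w_{[p,…,k;1,…,q]}) for all p = 1,…,k and q = 1,…,l; (b) x lies in the Zariski closure of B_k⁺ w B_l⁺ if and only if rank(x_{[p,…,k;1,…,q]}) ≤ rank(w_{[p,…,k;1,…,q]}) for all such p, q; (c) x ∈ B_k⁻ w B_l⁻ if and only if rank(x_{[1,…,p;q,…,l]}) = rank(w_{[1,…,p;q,…,l]}) for all p = 1,…,k and q = 1,…,l; (d) x lies in the Zariski closure of B_k⁻ w B_l⁻ if and only if rank(x_{[1,…,p;q,…,l]})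 ≤ rank(w_{[1,…,p;q,…,l]}) for all such p, q. -/
open Matrix

noncomputable section

namespace BruhatAux

variable {k l : ℕ}

def LowT (f : Fin k → ℕ) (b : Mat k k) : Prop := IsUnit b ∧ ∀ i j, f i < f j → b i j = 0
def UpT (g : Fin l → ℕ) (b : Mat l l) : Prop := IsUnit b ∧ ∀ i j, g j < g i → b i j = 0

def Eqv (f : Fin k → ℕ) (g : Fin l → ℕ) (x w : Mat k l) : Prop :=
  ∃ b, LowT f b ∧ ∃ b', UpT g b' ∧ x = b * w * b'

lemma UpT.mul {g : Fin l → ℕ} {a b : Mat l l} (ha : UpT g a) (hb : UpT g b) : UpT g (a * b) :=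
  ⟨ha.1.mul hb.1, fun i j h =>
    (Matrix.BlockTriangular.mul (b := g) (fun i j h => ha.2 i j h) (fun i j h => hb.2 i j h)) h⟩

lemma LowT.mul {g : Fin l → ℕ} {a b : Mat l l} (ha : LowT g a) (hb : LowT g b) : LowT g (a * b) :=
  ⟨ha.1.mul hb.1, fun i j h =>
    (Matrix.BlockTriangular.mul (b := OrderDual.toDual ∘ g)
      (fun i j h => ha.2 i j h) (fun i j h => hb.2 i j h)) h⟩

lemma UpT.inv {g : Fin l → ℕ} {a : Mat l l} (ha : UpT g a) : UpT g a⁻¹ := by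
  haveI := ha.1.invertible
  exact ⟨by simpa using ha.1, fun i j h =>
    (Matrix.blockTriangular_inv_of_blockTriangular (b := g) (fun i j h => ha.2 i j h)) h⟩

lemma LowT.inv {g : Fin l → ℕ} {a : Mat l l} (ha : LowT g a) : LowT g a⁻¹ := by
  haveI := ha.1.invertible
  exact ⟨by simpa using ha.1, fun i j h =>
    (Matrix.blockTriangular_inv_of_blockTriangular (b := OrderDual.toDual ∘ g)
      (fun i j h => ha.2 i j h)) h⟩

lemma UpT.one {g : Fin l → ℕ} : UpT g (1 : Mat l l) :=
  ⟨isUnit_one, fun i j h => Matrix.one_apply_ne (by rintro rfl; omega)⟩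
lemma LowT.one {g : Fin l → ℕ} : LowT g (1 : Mat l l) :=
  ⟨isUnit_one, fun i j h => Matrix.one_apply_ne (by rintro rfl; omega)⟩

variable {f : Fin k → ℕ} {g : Fin l → ℕ}

lemma Eqv.refl (x : Mat k l) : Eqv f g x x := ⟨1, LowT.one, 1, UpT.one, by simp⟩

lemma Eqv.trans {x y z : Mat k l} (h : Eqv f g x y) (h' : Eqv f g y z) : Eqv f g x z := by
  obtain ⟨a, ha, b, hb, rfl⟩ := h
  obtain ⟨c, hc, d, hd, rfl⟩ := h'
  exact ⟨a * c, ha.mul hc, d * b, hd.mul hb, by simp only [Matrix.mul_assoc]⟩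

lemma Eqv.symm {x y : Mat k l} (h : Eqv f g x y) : Eqv f g y x := by
  obtain ⟨a, ha, b, hb, rfl⟩ := h
  refine ⟨a⁻¹, ha.inv, b⁻¹, hb.inv, ?_⟩
  have h1 : a⁻¹ * a = 1 := Matrix.nonsing_inv_mul _ ((Matrix.isUnit_iff_isUnit_det _).1 ha.1)
  have h2 : b * b⁻¹ = 1 := Matrix.mul_nonsing_inv _ ((Matrix.isUnit_iff_isUnit_det _).1 hb.1)
  calc y = (a⁻¹ * a) * y * (b * b⁻¹) := by rw [h1, h2]; simp
    _ = _ := by simp only [Matrix.mul_assoc]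

/-- truncation to rows with `f i < P` and columns with `g j < Q` -/
def tr (f : Fin k → ℕ) (g : Fin l → ℕ) (P Q : ℕ) (x : Mat k l) : Mat k l :=
  fun i j => if f i < P ∧ g j < Q then x i j else 0

def T (f : Fin k → ℕ) (g : Fin l → ℕ) (P Q : ℕ) (x : Mat k l) : ℕ := (tr f g P Q x).rank

def DD (f : Fin k → ℕ) (P : ℕ) : Mat k k := Matrix.diagonal fun i => if f i < P then 1 else 0

lemma tr_eq (P Q : ℕ) (x : Mat k l) : tr f g P Q x = DD f P * x * DD g Q := by
  ext i j
  simp only [tr, DD, Matrix.mul_diagonal, Matrix.diagonal_mul]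
  split_ifs <;> simp_all

lemma DD_low (P : ℕ) {b : Mat k k} (hb : LowT f b) : DD f P * b = DD f P * b * DD f P := by
  ext i j
  simp only [DD, Matrix.mul_diagonal, Matrix.diagonal_mul]
  split_ifs <;> simp
  exact hb.2 i j (by omega)

lemma DD_up (P : ℕ) {b : Mat l l} (hb : UpT g b) : b * DD g P = DD g P * b * DD g P := by
  ext i j
  simp only [DD, Matrix.mul_diagonal, Matrix.diagonal_mul]
  split_ifs <;> simp
  exact hb.2 i j (by omega)

lemma T_le_of_eqv {x y : Mat k l} (h : Eqv f g x y) (P Q : ℕ) : T f g P Q x ≤ T f g P Q y := by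
  obtain ⟨a, ha, b, hb, rfl⟩ := h
  have : tr f g P Q (a * y * b) = (DD f P * a) * tr f g P Q y * (b * DD g Q) := by
    rw [tr_eq, tr_eq]
    calc DD f P * (a * y * b) * DD g Q = (DD f P * a) * y * (b * DD g Q) := by
          simp only [Matrix.mul_assoc]
      _ = (DD f P * a * DD f P) * y * (DD g Q * b * DD g Q) := by rw [← DD_low P ha, ← DD_up Q hb]
      _ = _ := by simp only [Matrix.mul_assoc]
  unfold T
  rw [this]
  exact (Matrix.rank_mul_le_left _ _).trans (Matrix.rank_mul_le_right _ _)

lemma T_eq_of_eqv {x y : Mat k l} (h : Eqv f g x y) (P Q : ℕ) : T f g P Q x = T f g P Q y :=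
  le_antisymm (T_le_of_eqv h P Q) (T_le_of_eqv h.symm P Q)

lemma subRank_eq {x : Mat k l} {R : Finset (Fin k)} {C : Finset (Fin l)} {P Q : ℕ}
    (hR : ∀ i, i ∈ R ↔ f i < P) (hC : ∀ j, j ∈ C ↔ g j < Q) : subRank x R C = T f g P Q x := by
  unfold subRank T
  apply le_antisymm
  · have : x.submatrix (fun i : {a // a ∈ R} => i.1) (fun j : {a // a ∈ C} => j.1) =
      (tr f g P Q x).submatrix (fun i : {a // a ∈ R} => i.1) (fun j : {a // a ∈ C} => j.1) := by
      ext i j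
      have h1 := (hR i.1).1 i.2
      have h2 := (hC j.1).1 j.2
      simp [tr, h1, h2]
    rw [this]
    exact Matrix.rank_submatrix_le _ _ _
  · have : tr f g P Q x = (Matrix.of fun (a : Fin k) (i : {a // a ∈ R}) => if a = i.1 then (1:ℂ) else 0)
       * x.submatrix (fun i : {a // a ∈ R} => i.1) (fun j : {a // a ∈ C} => j.1) *
       (Matrix.of fun (j : {a // a ∈ C}) (b : Fin l) => if b = j.1 then (1:ℂ) else 0) := by
      ext a b
      simp only [tr, Matrix.mul_apply, Matrix.of_apply, Matrix.submatrix_apply, ite_mul, one_mul,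
        zero_mul, mul_ite, mul_one, mul_zero, ← hR, ← hC]
      by_cases ha : a ∈ R
      · by_cases hb : b ∈ C
        · rw [if_pos ⟨ha, hb⟩, Finset.sum_eq_single ⟨b, hb⟩, if_pos rfl,
            Finset.sum_eq_single ⟨a, ha⟩, if_pos rfl]
          · intro i _ hi
            rw [if_neg]
            intro h; apply hi; ext; simp [h]
          · simp
          · intro i _ hi
            rw [if_neg]
            intro h; apply hi; ext; simp [h]
          · simp
        · rw [if_neg (fun h => hb h.2), Finset.sum_eq_zero]
          intro j _
          rw [if_neg]
          rintro rfl; exact hb j.2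
      · rw [if_neg (fun h => ha h.1), Finset.sum_eq_zero]
        intro j _
        split_ifs
        · rw [Finset.sum_eq_zero]
          intro i _
          rw [if_neg]
          rintro rfl; exact ha i.2
        · rfl
    rw [this]
    exact (Matrix.rank_mul_le_left _ _).trans (Matrix.rank_mul_le_right _ _)

/-- extending rank inequalities to all cutoffs -/
lemma T_le_all {x w : Mat k l}
    (h : ∀ p q, T f g (f p + 1) (g q + 1) x ≤ T f g (f p + 1) (g q + 1) w) (P Q : ℕ) :
    T f g P Q x ≤ T f g P Q w := by
  by_cases h1 : ∃ i, f i < P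
  · by_cases h2 : ∃ j, g j < Q
    · obtain ⟨p, hp, hp'⟩ := Finset.exists_max_image (Finset.univ.filter fun i => f i < P) f
        (by obtain ⟨i, hi⟩ := h1; exact ⟨i, by simpa using hi⟩)
      obtain ⟨q, hq, hq'⟩ := Finset.exists_max_image (Finset.univ.filter fun i => g i < Q) g
        (by obtain ⟨i, hi⟩ := h2; exact ⟨i, by simpa using hi⟩)
      simp only [Finset.mem_filter, Finset.mem_univ, true_and] at hp hp' hq hq'
      have e : ∀ y, tr f g P Q y = tr f g (f p + 1) (g q + 1) y := by
        intro y
        ext i j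
        have a1 : f i < P ↔ f i < f p + 1 := ⟨fun h => by have := hp' i h; omega, fun h => by omega⟩
        have a2 : g j < Q ↔ g j < g q + 1 := ⟨fun h => by have := hq' j h; omega, fun h => by omega⟩
        simp only [tr, a1, a2]
      have := h p q
      unfold T at this ⊢
      rwa [e, e]
    · have : tr f g P Q x = 0 := by
        ext i j
        simp only [tr, Matrix.zero_apply]
        rw [if_neg]
        exact fun h => h2 ⟨j, h.2⟩
      simp [T, this]
  · have : tr f g P Q x = 0 := by
      ext i j
      simp only [tr, Matrix.zero_apply]
      rw [if_neg]
      exact fun h => h1 ⟨i, h.1⟩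
    simp [T, this]

lemma det_updateCol_one (n : Fin k) (v : Fin k → ℂ) : ((1 : Mat k k).updateCol n v).det = v n := by
  rw [← Matrix.cramer_apply, Matrix.cramer_one]; rfl

lemma eqv_left (x : Mat k l) (n : Fin k) (z : Fin k → ℂ) (hz : z n ≠ 0)
    (hf : ∀ i, z i ≠ 0 → f n ≤ f i) :
    Eqv f g (fun i j => (if i = n then 0 else x i j) + z i * x n j) x := by
  refine ⟨(1 : Mat k k).updateCol n z, ⟨?_, ?_⟩, 1, UpT.one, ?_⟩
  · rw [Matrix.isUnit_iff_isUnit_det, det_updateCol_one]; exact hz.isUnit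
  · intro i j hij
    rw [Matrix.updateCol_apply]
    split_ifs with h
    · subst h; by_contra h; have := hf _ h; omega
    · exact Matrix.one_apply_ne (by rintro rfl; omega)
  · ext i j
    rw [Matrix.mul_one, Matrix.mul_apply, ← Finset.add_sum_erase _ _ (Finset.mem_univ n)]
    rw [Matrix.updateCol_self, add_comm]
    congr 1
    split_ifs with h
    · subst h
      symm; apply Finset.sum_eq_zero
      intro m hm
      rw [Matrix.updateCol_ne (Finset.ne_of_mem_erase hm),
        Matrix.one_apply_ne (Finset.ne_of_mem_erase hm).symm, zero_mul]
    · rw [Finset.sum_eq_single i]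
      · rw [Matrix.updateCol_ne h]; simp
      · intro m hm hm'
        rw [Matrix.updateCol_ne (Finset.ne_of_mem_erase hm), Matrix.one_apply_ne hm'.symm, zero_mul]
      · simp [h]

lemma eqv_right (x : Mat k l) (n : Fin l) (z : Fin l → ℂ) (hz : z n ≠ 0)
    (hg : ∀ i, z i ≠ 0 → g n ≤ g i) :
    Eqv f g (fun i j => (if j = n then 0 else x i j) + z j * x i n) x := by
  obtain ⟨b, hb, c, hc, h⟩ := eqv_left (f := g) (g := f) xᵀ n z hz hg
  refine ⟨cᵀ, ⟨?_, ?_⟩, bᵀ, ⟨?_, ?_⟩, ?_⟩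
  · exact (Matrix.isUnit_transpose _).2 hc.1
  · intro i j hij; exact hc.2 _ _ hij
  · exact (Matrix.isUnit_transpose _).2 hb.1
  · intro i j hij; exact hb.2 _ _ hij
  · have := congrArg Matrix.transpose h
    rw [Matrix.transpose_mul, Matrix.transpose_mul, Matrix.transpose_transpose, ← Matrix.mul_assoc] at this
    rw [← this]; rfl

def Good (u : Mat k l) (i : Fin k) : Prop :=
  ∀ j, u i j ≠ 0 → u i j = 1 ∧ (∀ j', j' ≠ j → u i j' = 0) ∧ (∀ i', i' ≠ i → u i' j = 0)

lemma exists_normal (hf : Function.Injective f) (hg : Function.Injective g) (x : Mat k l) (N : ℕ) :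
    ∃ u, Eqv f g u x ∧ ∀ i, f i < N → Good u i := by
  induction N with
  | zero => exact ⟨x, Eqv.refl x, by simp⟩
  | succ N ih =>
    obtain ⟨u, hu, hG⟩ := ih
    by_cases hn : ∃ n, f n = N
    swap
    · exact ⟨u, hu, fun i hi => hG i (by
        have : f i ≠ N := fun h => hn ⟨i, h⟩
        omega)⟩
    obtain ⟨n, hn⟩ := hn
    by_cases h0 : ∃ j, u n j ≠ 0
    swap
    · push Not at h0
      refine ⟨u, hu, fun i hi => ?_⟩
      by_cases h : f i = N
      · have : i = n := hf (by omega)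
        subst this
        intro j hj; exact absurd (h0 j) hj
      · exact hG i (by omega)
    obtain ⟨c, hc, hmin⟩ := Finset.exists_min_image (Finset.univ.filter fun j => u n j ≠ 0) g
      (by obtain ⟨i, hi⟩ := h0; exact ⟨i, by simpa using hi⟩)
    simp only [Finset.mem_filter, Finset.mem_univ, true_and] at hc hmin
    have hcol : ∀ i, f i < N → u i c = 0 := by
      intro i hi
      by_contra h
      exact hc ((hG i hi c h).2.2 n (by rintro rfl; omega))
    -- column operation
    have e1 := eqv_right (f := f) (g := g) u c (fun j => if j = c then 1 else - u n j / u n c)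
      (by simp) (by
        intro j hj
        by_cases h : j = c
        · rw [h]
        · simp only [h, if_false] at hj
          apply hmin
          intro h'; simp [h'] at hj)
    set y : Mat k l := _ with hy
    change Eqv f g y u at e1
    have e2 := eqv_left (f := f) (g := g) y n (fun i => if i = n then 1 / u n c else - u i c / u n c)
      (by simpa using hc) (by
        intro i hi
        by_cases h : i = n
        · rw [h]
        · simp only [h, if_false] at hi
          by_contra h'
          apply hi
          rw [hcol i (by omega)]; simp)
    set v : Mat k l := _ with hv
    change Eqv f g v y at e2
    have hvv : ∀ i j, v i j = if i = n then (if j = c then 1 else 0) else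
        if j = c then 0 else u i j - u i c * u n j / u n c := by
      intro i j
      by_cases h : i = n <;> by_cases h' : j = c <;> simp only [hv, hy, h, h', if_true, if_false] <;> field_simp <;> ring_nf
    clear_value v y
    refine ⟨v, e2.trans (e1.trans hu), ?_⟩
    intro i hi j hj
    rcases Nat.lt_or_ge (f i) N with h | h
    · have hin : i ≠ n := by rintro rfl; omega
      have hv' : ∀ j, v i j = u i j := by
        intro j
        rw [hvv, if_neg hin, hcol i h]
        split_ifs with h'
        · rw [h', hcol i h]
        · simp
      rw [hv'] at hj
      obtain ⟨g1, g2, g3⟩ := hG i h j hj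
      refine ⟨by rw [hv', g1], fun j' hj' => by rw [hv', g2 _ hj'], fun i' hi' => ?_⟩
      have hjc : j ≠ c := by rintro rfl; exact hj (hcol i h)
      rw [hvv]
      simp [hjc, g3 i' hi', g3 n hin.symm]
    · have : i = n := hf (by omega)
      subst this
      simp only [hvv, if_true] at hj ⊢
      have hjc : j = c := by by_contra h; simp [h] at hj
      subst hjc
      refine ⟨by simp, fun j' hj' => by simp [hj'], fun i' hi' => by simp [hi']⟩

lemma exists_normal' (hf : Function.Injective f) (hg : Function.Injective g) (x : Mat k l) :
    ∃ u, Eqv f g u x ∧ ∀ i, Good u i := by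
  obtain ⟨u, h, h'⟩ := exists_normal hf hg x (Finset.univ.sup f + 1)
  exact ⟨u, h, fun i => h' i (Nat.lt_succ_of_le (Finset.le_sup (Finset.mem_univ i)))⟩

def cnt (M : Mat k l) : ℕ := (Finset.univ.filter fun a : Fin k × Fin l => M a.1 a.2 ≠ 0).card

open scoped ComplexOrder in
lemma rank_monomial (M : Mat k l) (hr : ∀ i j j', M i j ≠ 0 → M i j' ≠ 0 → j = j')
    (hc : ∀ i i' j, M i j ≠ 0 → M i' j ≠ 0 → i = i') : M.rank = cnt M := by
  classical
  have : M * Mᴴ = Matrix.diagonal fun i => ∑ j, M i j * star (M i j) := by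
    ext i i'
    rw [Matrix.mul_apply]
    by_cases h : i = i'
    · subst h; simp
    · rw [Matrix.diagonal_apply_ne _ h]
      apply Finset.sum_eq_zero
      intro j _
      rw [Matrix.conjTranspose_apply]
      by_contra h'
      apply h
      apply hc i i' j
      · intro h; simp [h] at h'
      · intro h; simp [h] at h'
  rw [← Matrix.rank_self_mul_conjTranspose, this, Matrix.rank_diagonal, Fintype.card_subtype, cnt]
  symm
  have key : ∀ i, (∑ j, M i j * star (M i j)) ≠ 0 ↔ ∃ j, M i j ≠ 0 := by
    intro i
    constructor
    · intro h
      obtain ⟨j, _, hj⟩ := Finset.exists_ne_zero_of_sum_ne_zero h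
      exact ⟨j, fun h => by simp [h] at hj⟩
    · rintro ⟨j, hj⟩
      rw [Finset.sum_eq_single j]
      · simpa using hj
      · intro j' _ hj'
        by_contra h
        exact hj' (hr i j' j (fun h0 => by simp [h0] at h) hj)
      · simp
  apply Finset.card_bij (fun a _ => a.1)
  · intro a ha
    simp only [Finset.mem_filter, Finset.mem_univ, true_and] at ha ⊢
    exact (key _).2 ⟨_, ha⟩
  · intro a ha b hb hab
    simp only [Finset.mem_filter, Finset.mem_univ, true_and] at ha hb
    rw [← hab] at hb
    exact Prod.ext hab (hr _ _ _ ha hb)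
  · intro i hi
    simp only [Finset.mem_filter, Finset.mem_univ, true_and] at hi
    obtain ⟨j, hj⟩ := (key _).1 hi
    exact ⟨(i, j), by simpa using hj, rfl⟩

def cn (f : Fin k → ℕ) (g : Fin l → ℕ) (P Q : ℕ) (u : Mat k l) : ℕ :=
  (Finset.univ.filter fun a : Fin k × Fin l => f a.1 < P ∧ g a.2 < Q ∧ u a.1 a.2 ≠ 0).card

lemma Good.row {u : Mat k l} (hu : ∀ i, Good u i) {i j j'} (h : u i j ≠ 0) (h' : u i j' ≠ 0) :
    j = j' := by
  by_contra hne
  exact h' ((hu i j h).2.1 j' (fun e => hne e.symm))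

lemma Good.col {u : Mat k l} (hu : ∀ i, Good u i) {i i' j} (h : u i j ≠ 0) (h' : u i' j ≠ 0) :
    i = i' := by
  by_contra hne
  exact h' ((hu i j h).2.2 i' (fun e => hne e.symm))

lemma tr_ne {P Q : ℕ} {u : Mat k l} {i j} : tr f g P Q u i j ≠ 0 ↔ f i < P ∧ g j < Q ∧ u i j ≠ 0 := by
  unfold tr
  split_ifs with h
  · simp [h]
  · simp only [ne_eq, not_true_eq_false, false_iff]; tauto

lemma T_good {u : Mat k l} (hu : ∀ i, Good u i) (P Q : ℕ) : T f g P Q u = cn f g P Q u := by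
  unfold T
  rw [rank_monomial]
  · unfold cnt cn
    simp only [tr_ne]
  · intro i j j' h h'
    rw [tr_ne] at h h'
    exact Good.row hu h.2.2 h'.2.2
  · intro i j j' h h'
    rw [tr_ne] at h h'
    exact Good.col hu h.2.2 h'.2.2

lemma good_ext {u w : Mat k l} (hu : ∀ i, Good u i) (hw : ∀ i, Good w i) {i : Fin k} {a : Fin l}
    (h : u i a ≠ 0) (h' : w i a ≠ 0) : u i = w i := by
  ext j
  by_cases hj : j = a
  · subst hj; rw [(hu i j h).1, (hw i j h').1]
  · rw [(hu i a h).2.1 j hj, (hw i a h').2.1 j hj]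

lemma step (hf : Function.Injective f) (hg : Function.Injective g) {u w : Mat k l}
    (hu : ∀ i, Good u i) (hw : ∀ i, Good w i) (hne : u ≠ w)
    (hle : ∀ P Q, cn f g P Q u ≤ cn f g P Q w) :
    ∃ i c, (∀ a, u i a ≠ 0 → g c < g a) ∧ (∀ j, u j c ≠ 0 → f i < f j) ∧
      ∀ P Q, f i < P → g c < Q → (∀ a, u i a ≠ 0 → Q ≤ g a) → (∀ j, u j c ≠ 0 → P ≤ f j) →
        cn f g P Q u < cn f g P Q w := by
  classical
  obtain ⟨i, hi, himin⟩ := Finset.exists_min_image (Finset.univ.filter fun i => u i ≠ w i) f (by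
    by_contra h
    rw [Finset.not_nonempty_iff_eq_empty, Finset.filter_eq_empty_iff] at h
    apply hne
    funext i
    simpa using h (Finset.mem_univ i))
  simp only [Finset.mem_filter, Finset.mem_univ, true_and] at hi himin
  have hag : ∀ i', f i' < f i → u i' = w i' := by
    intro i' h
    by_contra h'
    have := himin i' h'
    omega
  -- the dot of w in row i
  obtain ⟨b, hb, hbu⟩ : ∃ b, w i b ≠ 0 ∧ ∀ a, u i a ≠ 0 → g b < g a := by
    by_cases ha : ∃ a, u i a ≠ 0
    · obtain ⟨a, ha⟩ := ha
      have hwa : w i a = 0 := by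
        by_contra h
        exact hi (good_ext hu hw ha h)
      obtain ⟨b, hb, hba⟩ : ∃ b, w i b ≠ 0 ∧ g b < g a + 1 := by
        by_contra hcon
        push Not at hcon
        have h1 := hle (f i + 1) (g a + 1)
        apply absurd h1
        rw [not_le]
        apply Finset.card_lt_card
        rw [Finset.ssubset_iff_of_subset]
        · refine ⟨(i, a), ?_, ?_⟩
          · simp [ha]
          · simp [hwa]
        · rintro ⟨p, q⟩ hpq
          simp only [Finset.mem_filter, Finset.mem_univ, true_and] at hpq ⊢
          refine ⟨hpq.1, hpq.2.1, ?_⟩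
          have hpi : f p ≠ f i := by
            intro h
            have := hf h
            subst this
            have := hcon q hpq.2.2
            omega
          rw [hag p (by omega)]
          exact hpq.2.2
      refine ⟨b, hb, fun a' ha' => ?_⟩
      have := Good.row hu ha ha'
      subst this
      have : g b ≠ g a := by
        intro h
        have := hg h
        subst this
        exact hb hwa
      omega
    · push Not at ha
      obtain ⟨b, hb⟩ : ∃ b, w i b ≠ 0 := by
        by_contra hcon
        push Not at hcon
        exact hi (by ext j; rw [ha, hcon])
      exact ⟨b, hb, fun a h => absurd (ha a) h⟩
  have hbcol : ∀ j, u j b ≠ 0 → f i < f j := by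
    intro j hj
    by_contra h
    have hji : j ≠ i := by
      rintro rfl
      have := hbu b hj
      omega
    have hji' : f j ≠ f i := fun h => hji (hf h)
    rw [hag j (by omega)] at hj
    exact hji (Good.col hw hj hb)
  -- the general counting argument
  have main : ∀ c, g b ≤ g c → ∀ P Q, f i < P → g c < Q → (∀ a, u i a ≠ 0 → Q ≤ g a) →
      (∀ j c', u j c' ≠ 0 → g b ≤ g c' → g c' < Q → f i < f j → P ≤ f j) →
      cn f g P Q u < cn f g P Q w := by
    intro c hbc P Q hiP hcQ hA hB
    have split : ∀ v : Mat k l, cn f g P Q v = cn f g P (g b) v +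
        (Finset.univ.filter fun a : Fin k × Fin l =>
          f a.1 < P ∧ g b ≤ g a.2 ∧ g a.2 < Q ∧ v a.1 a.2 ≠ 0).card := by
      intro v
      unfold cn
      rw [← Finset.card_union_of_disjoint]
      · congr 1
        ext a
        simp only [Finset.mem_filter, Finset.mem_univ, true_and, Finset.mem_union]
        constructor
        · rintro ⟨h1, h2, h3⟩
          rcases Nat.lt_or_ge (g a.2) (g b) with h | h
          · exact Or.inl ⟨h1, h, h3⟩
          · exact Or.inr ⟨h1, h, h2, h3⟩
        · rintro (⟨h1, h2, h3⟩ | ⟨h1, h2, h3, h4⟩)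
          · exact ⟨h1, by omega, h3⟩
          · exact ⟨h1, h3, h4⟩
      · rw [Finset.disjoint_left]
        intro a ha ha'
        simp only [Finset.mem_filter, Finset.mem_univ, true_and] at ha ha'
        omega
    rw [split u, split w]
    apply add_lt_add_of_le_of_lt (hle P (g b))
    apply Finset.card_lt_card
    rw [Finset.ssubset_iff_of_subset]
    · refine ⟨(i, b), ?_, ?_⟩
      · simp only [Finset.mem_filter, Finset.mem_univ, true_and]
        exact ⟨hiP, le_rfl, by omega, hb⟩
      · simp only [Finset.mem_filter, Finset.mem_univ, true_and]
        rintro ⟨_, _, _, h⟩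
        have := hbu b h
        omega
    · rintro ⟨p, q⟩ hpq
      simp only [Finset.mem_filter, Finset.mem_univ, true_and] at hpq ⊢
      obtain ⟨h1, h2, h3, h4⟩ := hpq
      refine ⟨h1, h2, h3, ?_⟩
      have hpi : f p ≠ f i := by
        intro h
        have := hf h
        subst this
        have := hA q h4
        omega
      have : f p < f i := by
        by_contra h
        have := hB p q h4 h2 h3 (by omega)
        omega
      rw [← hag p this]
      exact h4
  by_cases hS : ∃ a : Fin k × Fin l, u a.1 a.2 ≠ 0 ∧ f i < f a.1 ∧ g b ≤ g a.2 ∧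
      ∀ a', u i a' ≠ 0 → g a.2 < g a'
  · obtain ⟨⟨j, c⟩, hjc, hjmin⟩ := Finset.exists_min_image (Finset.univ.filter
      fun a : Fin k × Fin l => u a.1 a.2 ≠ 0 ∧ f i < f a.1 ∧ g b ≤ g a.2 ∧
      ∀ a', u i a' ≠ 0 → g a.2 < g a') (fun a => f a.1)
      (by obtain ⟨a, ha⟩ := hS; exact ⟨a, by simpa using ha⟩)
    simp only [Finset.mem_filter, Finset.mem_univ, true_and] at hjc hjmin
    obtain ⟨h1, h2, h3, h4⟩ := hjc
    refine ⟨i, c, h4, ?_, ?_⟩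
    · intro j' hj'
      rw [← Good.col hu h1 hj']
      exact h2
    · intro P Q hP hQ hA hC
      apply main c h3 P Q hP hQ hA
      intro j' c' h h' h'' h'''
      have := hjmin (j', c') ⟨h, h''', h', fun a' ha' => lt_of_lt_of_le h'' (hA a' ha')⟩
      have := hC j h1
      simp only at *
      omega
  · refine ⟨i, b, hbu, hbcol, ?_⟩
    intro P Q hP hQ hA hC
    apply main b le_rfl P Q hP hQ hA
    intro j' c' h h' h'' h'''
    exact absurd ⟨(j', c'), h, h''', h', fun a' ha' => lt_of_lt_of_le h'' (hA a' ha')⟩ hS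

/-- `u + t E_{ic}` -/
def pert (u : Mat k l) (i : Fin k) (c : Fin l) (t : ℂ) : Mat k l :=
  fun p q => u p q + if p = i ∧ q = c then t else 0

lemma pert_T_row {u : Mat k l} (hu : ∀ i, Good u i) {i : Fin k} {c a : Fin l} (ha : u i a ≠ 0)
    (hca : g c < g a) {P Q : ℕ} (hQ : g a < Q) (t : ℂ) :
    T f g P Q (pert u i c t) = T f g P Q u := by
  have hne : c ≠ a := by rintro rfl; omega
  have key : ∀ (s : ℂ) (v : Mat k l), (∀ p, v p a = u p a) →
      T f g P Q (pert v i c s) ≤ T f g P Q v := by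
    intro s v hv
    have : tr f g P Q (pert v i c s) = tr f g P Q v * (1 + Matrix.single a c s) := by
      ext p q
      rw [Matrix.mul_add, Matrix.mul_one, Matrix.add_apply]
      by_cases hq : q = c
      · subst hq
        rw [Matrix.mul_single_apply_same]
        simp only [tr, pert, hv]
        by_cases hp : p = i
        · subst hp
          rw [(hu p a ha).1]
          split_ifs <;> simp_all <;> omega
        · rw [(hu i a ha).2.2 p hp]
          simp [hp]
      · rw [Matrix.mul_single_apply_of_ne _ _ _ _ _ hq]
        simp [tr, pert, hq]
    unfold T
    rw [this]
    exact Matrix.rank_mul_le_left _ _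
  apply le_antisymm (key t u (fun _ => rfl))
  have := key (-t) (pert u i c t) (by intro p; simp [pert, hne.symm])
  have e : pert (pert u i c t) i c (-t) = u := by
    funext p q
    simp only [pert]
    split_ifs <;> simp
  rwa [e] at this

lemma pert_T_col {u : Mat k l} (hu : ∀ i, Good u i) {i j : Fin k} {c : Fin l} (ha : u j c ≠ 0)
    (hca : f i < f j) {P Q : ℕ} (hQ : f j < P) (t : ℂ) :
    T f g P Q (pert u i c t) = T f g P Q u := by
  have hne : i ≠ j := by rintro rfl; omega
  have key : ∀ (s : ℂ) (v : Mat k l), (∀ q, v j q = u j q) →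
      T f g P Q (pert v i c s) ≤ T f g P Q v := by
    intro s v hv
    have : tr f g P Q (pert v i c s) = (1 + Matrix.single i j s) * tr f g P Q v := by
      ext p q
      rw [Matrix.add_mul, Matrix.one_mul, Matrix.add_apply]
      by_cases hp : p = i
      · subst hp
        rw [Matrix.single_mul_apply_same]
        simp only [tr, pert, hv]
        by_cases hq : q = c
        · subst hq
          rw [(hu j q ha).1]
          split_ifs <;> simp_all <;> omega
        · rw [(hu j c ha).2.1 q hq]
          simp [hq]
      · rw [Matrix.single_mul_apply_of_ne _ _ _ _ _ hp]
        simp [tr, pert, hp]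
    unfold T
    rw [this]
    exact Matrix.rank_mul_le_right _ _
  apply le_antisymm (key t u (fun _ => rfl))
  have := key (-t) (pert u i c t) (by intro p; simp [pert, hne.symm])
  have e : pert (pert u i c t) i c (-t) = u := by
    funext p q
    simp only [pert]
    split_ifs <;> simp
  rwa [e] at this

lemma pert_T_succ {u : Mat k l} (hu : ∀ i, Good u i) {i : Fin k} {c : Fin l} {P Q : ℕ}
    (hP : f i < P) (hQ : g c < Q) (hA : ∀ a, u i a ≠ 0 → Q ≤ g a) (hC : ∀ j, u j c ≠ 0 → P ≤ f j)
    {t : ℂ} (ht : t ≠ 0) :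
    T f g P Q (pert u i c t) = cn f g P Q u + 1 := by
  have huic : u i c = 0 := by
    by_contra h
    have := hA c h
    omega
  have key : ∀ p q, tr f g P Q (pert u i c t) p q ≠ 0 ↔
      (p = i ∧ q = c) ∨ (p ≠ i ∧ q ≠ c ∧ f p < P ∧ g q < Q ∧ u p q ≠ 0) := by
    intro p q
    rw [tr_ne]
    by_cases h1 : p = i
    · by_cases h2 : q = c
      · subst h1 h2; simp [pert, huic, hP, hQ, ht]
      · subst h1
        simp only [pert, h2, and_false, if_false, add_zero, ne_eq, not_true_eq_false, false_and, or_false, iff_false]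
        rintro ⟨_, h, h'⟩
        have := hA q h'
        omega
    · by_cases h2 : q = c
      · subst h2
        simp only [pert, h1, false_and, if_false, add_zero, ne_eq, not_true_eq_false, and_false, or_false, iff_false]
        rintro ⟨h, _, h'⟩
        have := hC p h'
        omega
      · simp [pert, h1, h2]
  unfold T
  rw [rank_monomial]
  · unfold cnt cn
    simp only [key]
    rw [← Finset.card_insert_of_notMem (a := (i, c)) (by simp [huic])]
    congr 1
    ext ⟨p, q⟩
    simp only [Finset.mem_filter, Finset.mem_univ, true_and, Finset.mem_insert, Prod.mk.injEq]
    constructor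
    · tauto
    · rintro (h | h)
      · exact Or.inl h
      · by_cases h1 : p = i
        · subst h1; have := hA q h.2.2; omega
        · by_cases h2 : q = c
          · subst h2; have := hC p h.2.2; omega
          · tauto
  · intro p q q' h h'
    rw [key] at h h'
    rcases h with ⟨h1, h2⟩ | h <;> rcases h' with ⟨h3, h4⟩ | h'
    · rw [h2, h4]
    · tauto
    · tauto
    · exact Good.row hu h.2.2.2.2 h'.2.2.2.2
  · intro p q q' h h'
    rw [key] at h h'
    rcases h with ⟨h1, h2⟩ | h <;> rcases h' with ⟨h3, h4⟩ | h'
    · rw [h1, h3]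
    · tauto
    · tauto
    · exact Good.col hu h.2.2.2.2 h'.2.2.2.2

lemma pert_T_out (u : Mat k l) {i : Fin k} {c : Fin l} {P Q : ℕ}
    (h : ¬ (f i < P ∧ g c < Q)) (t : ℂ) : T f g P Q (pert u i c t) = T f g P Q u := by
  unfold T
  congr 1
  ext p q
  simp only [tr, pert]
  by_cases hpq : p = i ∧ q = c
  · obtain ⟨rfl, rfl⟩ := hpq
    rw [if_neg h, if_neg h]
  · simp [hpq]

lemma zC_act {w x : Mat k l} (h : x ∈ zClosure {y | Eqv f g y w}) {y : Mat k l}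
    (hy : Eqv f g y x) : y ∈ zClosure {y | Eqv f g y w} := by
  obtain ⟨a, ha, b, hb, rfl⟩ := hy
  intro p hp
  let φ : Fin k × Fin l → MvPolynomial (Fin k × Fin l) ℂ := fun q =>
    ∑ d, (∑ c, MvPolynomial.C (a q.1 c) * MvPolynomial.X (c, d)) * MvPolynomial.C (b d q.2)
  have hev : ∀ z : Mat k l, MvPolynomial.eval (fun q => z q.1 q.2) (MvPolynomial.bind₁ φ p) =
      MvPolynomial.eval (fun q => (a * z * b) q.1 q.2) p := by
    intro z
    rw [← MvPolynomial.coe_aeval_eq_eval, ← MvPolynomial.coe_aeval_eq_eval]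
    change MvPolynomial.aeval _ (MvPolynomial.bind₁ φ p) = MvPolynomial.aeval _ p
    rw [MvPolynomial.aeval_bind₁]
    congr 2
    funext q
    simp [φ, Matrix.mul_apply]
  rw [← hev]
  apply h
  intro z hz
  rw [hev]
  apply hp
  exact Eqv.trans ⟨a, ha, b, hb, rfl⟩ hz

lemma zC_lim {S : Set (Mat k l)} {u : Mat k l} {i : Fin k} {c : Fin l}
    (h : ∀ t : ℂ, t ≠ 0 → pert u i c t ∈ zClosure S) : u ∈ zClosure S := by
  intro p hp
  have hc : Continuous fun t : ℂ => MvPolynomial.eval (fun q => pert u i c t q.1 q.2) p := by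
    apply (MvPolynomial.continuous_eval p).comp
    apply continuous_pi
    intro q
    simp only [pert]
    split_ifs <;> fun_prop
  have := Continuous.ext_on (dense_compl_singleton (0 : ℂ)) hc
    (continuous_const (y := (0 : ℂ))) (fun t ht => h t ht p hp)
  have h0 := congrFun this 0
  have e : pert u i c 0 = u := by
    funext p q
    simp [pert]
  simpa [e] using h0

lemma exists_factor (M : Mat k l) : ∃ (A : Matrix (Fin M.rank) (Fin k) ℂ)
    (B : Matrix (Fin l) (Fin M.rank) ℂ), A * M * B = 1 := by
  let F := M.mulVecLin
  let bs : Module.Basis (Fin M.rank) ℂ (LinearMap.range F) := Module.finBasis ℂ _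
  have hB : ∀ i, ∃ v, F v = (bs i : Fin k → ℂ) := fun i => (bs i).2
  choose v hv using hB
  obtain ⟨G, hG⟩ := LinearMap.exists_leftInverse_of_injective
    ((LinearMap.range F).subtype) (Submodule.ker_subtype _)
  let L : (Fin k → ℂ) →ₗ[ℂ] (Fin M.rank → ℂ) := bs.equivFun.toLinearMap ∘ₗ G
  refine ⟨LinearMap.toMatrix' L, Matrix.of fun j i => v i j, ?_⟩
  apply Matrix.ext_of_mulVec_single
  intro i
  have h1 : (Matrix.of fun j i => v i j) *ᵥ Pi.single i (1:ℂ) = v i := by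
    ext j; simp
  rw [← Matrix.mulVec_mulVec, h1, ← Matrix.mulVec_mulVec, LinearMap.toMatrix'_mulVec]
  have h2 : M *ᵥ v i = (bs i : Fin k → ℂ) := hv i
  rw [h2]
  have h3 : G (bs i : Fin k → ℂ) = bs i := by
    have := LinearMap.congr_fun hG (bs i)
    simpa using this
  simp only [L, LinearMap.comp_apply, h3]
  ext j
  simp [Pi.single_apply, Finsupp.single_apply, Matrix.one_apply, eq_comm]

lemma zC_rank {S : Set (Mat k l)} {x : Mat k l} (hx : x ∈ zClosure S) (P Q n : ℕ)
    (hS : ∀ y ∈ S, T f g P Q y ≤ n) : T f g P Q x ≤ n := by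
  obtain ⟨A, B, hAB⟩ := exists_factor (tr f g P Q x)
  let N : Matrix (Fin k) (Fin l) (MvPolynomial (Fin k × Fin l) ℂ) :=
    Matrix.of fun i j => if f i < P ∧ g j < Q then MvPolynomial.X (i, j) else 0
  let A' : Matrix (Fin (tr f g P Q x).rank) (Fin k) (MvPolynomial (Fin k × Fin l) ℂ) :=
    Matrix.of fun i j => MvPolynomial.C (A i j)
  let B' : Matrix (Fin l) (Fin (tr f g P Q x).rank) (MvPolynomial (Fin k × Fin l) ℂ) :=
    Matrix.of fun i j => MvPolynomial.C (B i j)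
  let p := (A' * N * B').det
  have hev : ∀ z : Mat k l, MvPolynomial.eval (fun q => z q.1 q.2) p =
      (A * tr f g P Q z * B).det := by
    intro z
    simp only [p]
    rw [RingHom.map_det]
    congr 1
    rw [RingHom.mapMatrix_apply, Matrix.map_mul, Matrix.map_mul]
    congr 2
    · ext i j; simp [A']
    · ext i j
      simp only [N, tr, Matrix.map_apply, Matrix.of_apply]
      split_ifs <;> simp
    · ext i j; simp [B']
  by_contra hcon
  have h1 : MvPolynomial.eval (fun q => x q.1 q.2) p = 0 := by
    apply hx
    intro y hy
    rw [hev]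
    by_contra hdet
    have hr := Matrix.rank_of_isUnit _ ((Matrix.isUnit_iff_isUnit_det _).2 (Ne.isUnit hdet))
    have h2 : (A * tr f g P Q y * B).rank ≤ (tr f g P Q y).rank :=
      (Matrix.rank_mul_le_left _ _).trans (Matrix.rank_mul_le_right _ _)
    have h3 := hS y hy
    rw [hr, Fintype.card_fin] at h2
    unfold T at *
    omega
  rw [hev, hAB] at h1
  simp at h1

lemma zC_of_le (hf : Function.Injective f) (hg : Function.Injective g) {w : Mat k l}
    (hw : ∀ i, Good w i) : ∀ (N : ℕ) (x : Mat k l),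
    (∀ P Q, T f g P Q x ≤ T f g P Q w) →
    (∑ p, ∑ q, T f g (f p + 1) (g q + 1) w) ≤ (∑ p, ∑ q, T f g (f p + 1) (g q + 1) x) + N →
    x ∈ zClosure {y | Eqv f g y w} := by
  intro N
  induction N with
  | zero =>
    intro x hx hs
    obtain ⟨u, hu, hG⟩ := exists_normal' hf hg x
    by_cases he : u = w
    · subst he
      intro p hp
      exact hp x hu.symm
    exfalso
    have hcn : ∀ P Q, cn f g P Q u ≤ cn f g P Q w := by
      intro P Q
      rw [← T_good hG, ← T_good hw, T_eq_of_eqv hu]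
      exact hx P Q
    obtain ⟨i, c, h1, h2, h3⟩ := step hf hg hG hw he hcn
    have h4 := h3 (f i + 1) (g c + 1) (by omega) (by omega) (fun a ha => h1 a ha)
      (fun a ha => h2 a ha)
    rw [← T_good hG, ← T_good hw, T_eq_of_eqv hu] at h4
    apply absurd hs
    rw [not_le, add_zero]
    apply Finset.sum_lt_sum (fun p _ => Finset.sum_le_sum fun q _ => hx _ _)
    exact ⟨i, Finset.mem_univ _, Finset.sum_lt_sum (fun q _ => hx _ _) ⟨c, Finset.mem_univ _, h4⟩⟩
  | succ N ih =>
    intro x hx hs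
    obtain ⟨u, hu, hG⟩ := exists_normal' hf hg x
    by_cases he : u = w
    · subst he
      intro p hp
      exact hp x hu.symm
    have hcn : ∀ P Q, cn f g P Q u ≤ cn f g P Q w := by
      intro P Q
      rw [← T_good hG, ← T_good hw, T_eq_of_eqv hu]
      exact hx P Q
    obtain ⟨i, c, h1, h2, h3⟩ := step hf hg hG hw he hcn
    refine zC_act ?_ hu.symm
    apply zC_lim (i := i) (c := c)
    intro t ht
    have htri : ∀ P Q, T f g P Q (pert u i c t) = T f g P Q u ∨
        (T f g P Q (pert u i c t) = cn f g P Q u + 1 ∧ cn f g P Q u < cn f g P Q w) := by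
      intro P Q
      by_cases a1 : f i < P ∧ g c < Q
      swap
      · exact Or.inl (pert_T_out u a1 t)
      by_cases a2 : ∃ a, u i a ≠ 0 ∧ g a < Q
      · obtain ⟨a, ha, ha'⟩ := a2
        exact Or.inl (pert_T_row hG ha (h1 a ha) ha' t)
      by_cases a3 : ∃ j, u j c ≠ 0 ∧ f j < P
      · obtain ⟨a, ha, ha'⟩ := a3
        exact Or.inl (pert_T_col hG ha (h2 a ha) ha' t)
      push Not at a2 a3
      exact Or.inr ⟨pert_T_succ hG a1.1 a1.2 a2 a3 ht, h3 P Q a1.1 a1.2 a2 a3⟩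
    have hge : ∀ P Q, T f g P Q x ≤ T f g P Q (pert u i c t) := by
      intro P Q
      rw [← T_eq_of_eqv hu]
      rcases htri P Q with h | h
      · rw [h]
      · rw [h.1, T_good hG]; omega
    have hgt : T f g (f i + 1) (g c + 1) x < T f g (f i + 1) (g c + 1) (pert u i c t) := by
      rw [← T_eq_of_eqv hu, T_good hG, pert_T_succ hG (by omega) (by omega) (fun a ha => h1 a ha)
        (fun a ha => h2 a ha) ht]
      exact Nat.lt_succ_self _
    apply ih
    · intro P Q
      rcases htri P Q with h | h
      · rw [h, T_eq_of_eqv hu]; exact hx P Q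
      · rw [h.1, T_good hw]; omega
    · have : (∑ p, ∑ q, T f g (f p + 1) (g q + 1) x) <
          ∑ p, ∑ q, T f g (f p + 1) (g q + 1) (pert u i c t) := by
        apply Finset.sum_lt_sum (fun p _ => Finset.sum_le_sum fun q _ => hge _ _)
        exact ⟨i, Finset.mem_univ _,
          Finset.sum_lt_sum (fun q _ => hge _ _) ⟨c, Finset.mem_univ _, hgt⟩⟩
      omega

theorem main (hf : Function.Injective f) (hg : Function.Injective g) (x w : Mat k l) :
    (Eqv f g x w ↔ ∀ p q, T f g (f p + 1) (g q + 1) x = T f g (f p + 1) (g q + 1) w) ∧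
    (x ∈ zClosure {y | Eqv f g y w} ↔
      ∀ p q, T f g (f p + 1) (g q + 1) x ≤ T f g (f p + 1) (g q + 1) w) := by
  obtain ⟨w', hw, hG⟩ := exists_normal' hf hg w
  refine ⟨⟨fun h p q => T_eq_of_eqv h _ _, fun h => ?_⟩, ⟨fun h p q => ?_, fun h => ?_⟩⟩
  · obtain ⟨u, hu, hGu⟩ := exists_normal' hf hg x
    have hle := T_le_all (f := f) (g := g) (fun p q => (h p q).le)
    have hge := T_le_all (f := f) (g := g) (fun p q => (h p q).ge)
    have hcn : ∀ P Q, cn f g P Q u = cn f g P Q w' := by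
      intro P Q
      rw [← T_good hGu, ← T_good hG, T_eq_of_eqv hu, T_eq_of_eqv hw]
      exact le_antisymm (hle P Q) (hge P Q)
    by_cases he : u = w'
    · subst he
      exact hu.symm.trans hw
    · exfalso
      obtain ⟨i, c, h1, h2, h3⟩ := step hf hg hGu hG he (fun P Q => (hcn P Q).le)
      have h4 := h3 (f i + 1) (g c + 1) (by omega) (by omega) (fun a ha => h1 a ha)
        (fun a ha => h2 a ha)
      rw [hcn] at h4
      omega
  · exact zC_rank h _ _ _ (fun y hy => (T_eq_of_eqv hy _ _).le)
  · have hle := T_le_all (f := f) (g := g) h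
    have hset : {y | Eqv f g y w} = {y | Eqv f g y w'} := by
      ext y
      exact ⟨fun h => Eqv.trans h hw.symm, fun h => Eqv.trans h hw⟩
    rw [hset]
    apply zC_of_le hf hg hG (∑ p, ∑ q, T f g (f p + 1) (g q + 1) w')
    · intro P Q
      rw [T_eq_of_eqv hw]
      exact hle P Q
    · omega

end BruhatAux

theorem statement6 (k l : ℕ) (hk : 0 < k) (hl : 0 < l) (x w : Mat k l) :
    -- (a)
    (x ∈ dcPlus w ↔ ∀ (p : Fin k) (q : Fin l),
      subRank x (Finset.Ici p) (Finset.Iic q) = subRank w (Finset.Ici p) (Finset.Iic q)) ∧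
    -- (b)
    (x ∈ zClosure (dcPlus w) ↔ ∀ (p : Fin k) (q : Fin l),
      subRank x (Finset.Ici p) (Finset.Iic q) ≤ subRank w (Finset.Ici p) (Finset.Iic q)) ∧
    -- (c)
    (x ∈ dcMinus w ↔ ∀ (p : Fin k) (q : Fin l),
      subRank x (Finset.Iic p) (Finset.Ici q) = subRank w (Finset.Iic p) (Finset.Ici q)) ∧
    -- (d)
    (x ∈ zClosure (dcMinus w) ↔ ∀ (p : Fin k) (q : Fin l),
      subRank x (Finset.Iic p) (Finset.Ici q) ≤ subRank w (Finset.Iic p) (Finset.Ici q)) := by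
  obtain ⟨ha, hb⟩ := BruhatAux.main (f := fun i : Fin k => (Fin.rev i : ℕ))
    (g := fun j : Fin l => (j : ℕ)) (fun i j h => Fin.rev_injective (Fin.ext h))
    (fun i j h => Fin.ext h) x w
  obtain ⟨hc, hd⟩ := BruhatAux.main (f := fun i : Fin k => (i : ℕ))
    (g := fun j : Fin l => (Fin.rev j : ℕ)) (fun i j h => Fin.ext h)
    (fun i j h => Fin.rev_injective (Fin.ext h)) x w
  have e1 : dcPlus w = {y | BruhatAux.Eqv (fun i : Fin k => (Fin.rev i : ℕ))
      (fun j : Fin l => (j : ℕ)) y w} := by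
    ext y
    simp only [dcPlus, Bp, BruhatAux.Eqv, BruhatAux.LowT, BruhatAux.UpT, Set.mem_setOf_eq,
      Fin.val_fin_lt, Fin.rev_lt_rev]
  have e2 : dcMinus w = {y | BruhatAux.Eqv (fun i : Fin k => (i : ℕ))
      (fun j : Fin l => (Fin.rev j : ℕ)) y w} := by
    ext y
    simp only [dcMinus, Bm, BruhatAux.Eqv, BruhatAux.LowT, BruhatAux.UpT, Set.mem_setOf_eq,
      Fin.val_fin_lt, Fin.rev_lt_rev]
  have r1 : ∀ (y : Mat k l) (p : Fin k) (q : Fin l),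
      subRank y (Finset.Ici p) (Finset.Iic q) = BruhatAux.T (fun i : Fin k => (Fin.rev i : ℕ))
      (fun j : Fin l => (j : ℕ)) ((Fin.rev p : ℕ) + 1) ((q : ℕ) + 1) y := by
    intro y p q
    apply BruhatAux.subRank_eq
    · intro i
      rw [Finset.mem_Ici, Nat.lt_succ_iff, Fin.val_fin_le, Fin.rev_le_rev]
    · intro i
      rw [Finset.mem_Iic, Nat.lt_succ_iff, Fin.val_fin_le]
  have r2 : ∀ (y : Mat k l) (p : Fin k) (q : Fin l),
      subRank y (Finset.Iic p) (Finset.Ici q) = BruhatAux.T (fun i : Fin k => (i : ℕ))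
      (fun j : Fin l => (Fin.rev j : ℕ)) ((p : ℕ) + 1) ((Fin.rev q : ℕ) + 1) y := by
    intro y p q
    apply BruhatAux.subRank_eq
    · intro i
      rw [Finset.mem_Iic, Nat.lt_succ_iff, Fin.val_fin_le]
    · intro i
      rw [Finset.mem_Ici, Nat.lt_succ_iff, Fin.val_fin_le, Fin.rev_le_rev]
  simp only [r1, r2, e1, e2]
  exact ⟨ha, hb, hc, hd⟩
end
end
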